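/- arXiv:math/9902004 — 3 statements merged into one kernel-verified Lean document; each statement's English description precedes it below -/
import Mathlib

section
/- Let x, y, n be nonnegative integers with x + y ≥ 1. Then, as an identity of rational numbers, det_{0≤i,j≤n−1}( (x+y+i+j−1)! / ((x+2i−j)!·(y+2j−i)!) ) = ∏_{i=0}^{n−1} ( i!·(x+y+i−1)!·(2x+y+2i)_i·(x+2y+2i)_i / ((x+2i)!·(y+2i)!) ), where an entry is interpreted as 0 whenever x+2i−j < 0 or y+2j−i < 0 (i.e. the reciprocal of the factorial of a negative integer is 0), and (a)_k := a(a+1)···(a+k−1) with (a)_0 := 1. -/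
open Finset

/-- `invFactQ m` is `1/m!` for `m ≥ 0` and `0` for negative integers `m`. -/
def invFactQ (m : ℤ) : ℚ :=
  if 0 ≤ m then ((m.toNat.factorial : ℚ))⁻¹ else 0

/-- The **Desnanot–Jacobi identity** up to a factor of the determinant. -/
theorem Matrix.det_mul_desnanot_jacobi {R : Type*} [CommRing R] {n : ℕ}
    (A : Matrix (Fin (n + 2)) (Fin (n + 2)) R) :
    A.det * (A.adjugate 0 0 * A.adjugate (Fin.last _) (Fin.last _) -
        A.adjugate 0 (Fin.last _) * A.adjugate (Fin.last _) 0) =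
      A.det * (A.det *
        (A.submatrix (fun i : Fin n => i.castSucc.succ) (fun i : Fin n => i.castSucc.succ)).det) := by
  have h0 : (0 : Fin (n + 2)) ≠ Fin.last (n + 1) := (Fin.last_pos).ne
  set U : Matrix (Fin (n + 2)) (Fin 2) R := Matrix.of fun i j =>
    A.adjugate i (![0, Fin.last (n + 1)] j) - (1 : Matrix (Fin (n + 2)) (Fin (n + 2)) R) i (![0, Fin.last (n + 1)] j) with hU
  set V : Matrix (Fin 2) (Fin (n + 2)) R := Matrix.of fun i j =>
    (1 : Matrix (Fin (n + 2)) (Fin (n + 2)) R) (![0, Fin.last (n + 1)] i) j with hV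
  have hB : (1 + U * V).det = A.adjugate 0 0 * A.adjugate (Fin.last _) (Fin.last _) -
        A.adjugate 0 (Fin.last _) * A.adjugate (Fin.last _) 0 := by
    have hVU : 1 + V * U = Matrix.of fun i j : Fin 2 =>
        A.adjugate (![0, Fin.last (n + 1)] i) (![0, Fin.last (n + 1)] j) := by
      ext i j
      rw [Matrix.add_apply, Matrix.mul_apply]
      simp only [hU, hV, Matrix.of_apply, Matrix.one_apply, ite_mul, one_mul, zero_mul,
        Finset.sum_ite_eq, Finset.mem_univ, if_true]
      fin_cases i <;> fin_cases j <;> simp [h0, h0.symm]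
    rw [Matrix.det_one_add_mul_comm, hVU, Matrix.det_fin_two]
    simp
  have hAB : A * (1 + U * V) = (A.updateCol 0 (A.det • Pi.single 0 1)).updateCol (Fin.last _)
      (A.det • Pi.single (Fin.last _) 1) := by
    have hAU : ∀ i j, (A * U) i j = A.det * (1 : Matrix (Fin (n + 2)) (Fin (n + 2)) R) i (![0, Fin.last (n + 1)] j)
        - A i (![0, Fin.last (n + 1)] j) := by
      intro i j
      have h1 : U = A.adjugate.submatrix id ![0, Fin.last (n + 1)] -
          (1 : Matrix (Fin (n + 2)) (Fin (n + 2)) R).submatrix id ![0, Fin.last (n + 1)] := by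
        ext i j; rfl
      have h2 : A * U = (A.det • (1 : Matrix (Fin (n + 2)) (Fin (n + 2)) R) - A).submatrix id ![0, Fin.last (n + 1)] := by
        rw [h1, Matrix.mul_sub, ← Matrix.mul_adjugate]
        ext i j
        simp [Matrix.mul_apply, Matrix.one_apply]
      rw [h2]
      simp
    ext i j
    rw [Matrix.mul_add, Matrix.mul_one, ← Matrix.mul_assoc, Matrix.add_apply, Matrix.mul_apply,
      Fin.sum_univ_two, hAU, hAU]
    by_cases hl : j = Fin.last _
    · subst hl
      simp [hV, h0, Matrix.one_apply, Pi.single_apply]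
    · by_cases hz : j = 0
      · subst hz
        by_cases hi : i = 0 <;> simp [hV, h0.symm, hi, Matrix.one_apply]
      · simp [hV, hl, hz, Ne.symm hl, Ne.symm hz, Matrix.one_apply]
  have key := congrArg Matrix.det hAB
  rw [Matrix.det_mul, hB, Matrix.det_updateCol_smul, Matrix.updateCol_comm _ h0,
    Matrix.det_updateCol_smul, ← Matrix.cramer_apply, Matrix.cramer_eq_adjugate_mulVec,
    Matrix.mulVec_single_one, Matrix.col_apply,
    Matrix.adjugate_fin_succ_eq_det_submatrix (A.updateCol _ _)] at key
  rw [key]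
  congr 2
  have hsub : ((A.updateCol (Fin.last (n + 1)) (Pi.single (Fin.last (n + 1)) 1)).submatrix
      (Fin.succAbove 0) (Fin.succAbove 0)) =
      (A.submatrix Fin.succ Fin.succ).updateCol (Fin.last n) (Pi.single (Fin.last n) 1) := by
    ext i j
    simp [Matrix.updateCol_apply, Pi.single_apply, -Fin.succ_last]
  rw [hsub, ← Matrix.cramer_apply, Matrix.cramer_eq_adjugate_mulVec,
    Matrix.mulVec_single_one, Matrix.col_apply, Matrix.adjugate_fin_succ_eq_det_submatrix]
  simp only [Fin.val_zero, pow_zero, one_mul, Fin.val_last, ← two_mul, pow_mul,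
    neg_one_sq, one_pow, Fin.succAbove_last, Matrix.submatrix_submatrix]
  rfl

/-- The **Desnanot–Jacobi identity** (Dodgson condensation), in terms of the adjugate. -/
theorem Matrix.desnanot_jacobi_adjugate {R : Type*} [CommRing R] {n : ℕ}
    (A : Matrix (Fin (n + 2)) (Fin (n + 2)) R) :
    A.adjugate 0 0 * A.adjugate (Fin.last _) (Fin.last _) -
        A.adjugate 0 (Fin.last _) * A.adjugate (Fin.last _) 0 =
      A.det *
        (A.submatrix (fun i : Fin n => i.castSucc.succ) (fun i : Fin n => i.castSucc.succ)).det := by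
  let X := Matrix.mvPolynomialX (Fin (n + 2)) (Fin (n + 2)) ℤ
  have hX := mul_left_cancel₀ (Matrix.det_mvPolynomialX_ne_zero (Fin (n + 2)) ℤ)
    (Matrix.det_mul_desnanot_jacobi X)
  let f : MvPolynomial (Fin (n + 2) × Fin (n + 2)) ℤ →+* R :=
    MvPolynomial.eval₂Hom (Int.castRingHom R) fun p => A p.1 p.2
  have hf : f.mapMatrix X = A := by
    ext i j
    simp [X, f]
  have hs : f.mapMatrix (X.submatrix (fun i : Fin n => i.castSucc.succ)
      (fun i : Fin n => i.castSucc.succ)) =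
      A.submatrix (fun i : Fin n => i.castSucc.succ) (fun i : Fin n => i.castSucc.succ) := by
    rw [← hf]; rfl
  have ha : ∀ i j, f (X.adjugate i j) = A.adjugate i j := fun i j => by
    rw [← hf, ← RingHom.map_adjugate]; rfl
  have := congrArg f hX
  simpa only [map_sub, map_mul, RingHom.map_det, ha, hf, hs] using this

/-- The **Desnanot–Jacobi identity** (Dodgson condensation), in terms of minors. -/
theorem Matrix.desnanot_jacobi {R : Type*} [CommRing R] {n : ℕ}
    (A : Matrix (Fin (n + 2)) (Fin (n + 2)) R) :
    A.det *
        (A.submatrix (fun i : Fin n => i.castSucc.succ) (fun i : Fin n => i.castSucc.succ)).det =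
      (A.submatrix Fin.castSucc Fin.castSucc).det * (A.submatrix Fin.succ Fin.succ).det -
        (A.submatrix Fin.succ Fin.castSucc).det * (A.submatrix Fin.castSucc Fin.succ).det := by
  rw [← Matrix.desnanot_jacobi_adjugate]
  have hs : ((-1 : R) ^ (n + 1)) * (-1) ^ (n + 1) = 1 := by
    rw [← mul_pow]; simp
  have hz : (Fin.succAbove (0 : Fin (n + 2))) = Fin.succ := by
    funext i; exact Fin.zero_succAbove i
  simp only [Matrix.adjugate_fin_succ_eq_det_submatrix, Fin.succAbove_last, hz, Fin.val_zero,
    Fin.val_last, add_zero, zero_add, pow_zero, one_mul, pow_add _ (n + 1) (n + 1), hs]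
  linear_combination (-(A.submatrix Fin.succ Fin.castSucc).det *
    (A.submatrix Fin.castSucc Fin.succ).det) * hs

/-- The matrix with entries `(x + y + i + j - 1)! / ((x + 2i - j)! (y + 2j - i)!)`. -/
def factorialMatrix (x y n : ℕ) : Matrix (Fin n) (Fin n) ℚ :=
  Matrix.of fun i j : Fin n =>
    ((x + y + (i : ℕ) + (j : ℕ) - 1).factorial : ℚ) *
      invFactQ ((x : ℤ) + 2 * ((i : ℕ) : ℤ) - ((j : ℕ) : ℤ)) *
      invFactQ ((y : ℤ) + 2 * ((j : ℕ) : ℤ) - ((i : ℕ) : ℤ))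

/-- The `i`-th factor of the product evaluating `(factorialMatrix x y n).det`. -/
noncomputable def detFactor (x y i : ℕ) : ℚ :=
  ((i.factorial : ℚ) * ((x + y + i - 1).factorial : ℚ) *
      (ascPochhammer ℚ i).eval ((2 * x + y + 2 * i : ℕ) : ℚ) *
      (ascPochhammer ℚ i).eval ((x + 2 * y + 2 * i : ℕ) : ℚ)) /
    (((x + 2 * i).factorial : ℚ) * ((y + 2 * i).factorial : ℚ))

theorem ascPochhammer_eval_eq_div (p i : ℕ) :
    (ascPochhammer ℚ i).eval ((p + 1 : ℕ) : ℚ) = ((p + i).factorial : ℚ) / (p.factorial : ℚ) := by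
  rw [eq_div_iff (by positivity), mul_comm]
  push_cast
  exact factorial_mul_ascPochhammer ℚ p i

theorem detFactor_eq (x y i : ℕ) {s p q : ℕ} (hs : x + y + i = s + 1)
    (hp : 2 * x + y + 2 * i = p + 1) (hq : x + 2 * y + 2 * i = q + 1) :
    detFactor x y i =
      (i.factorial * s.factorial * (p + i).factorial * (q + i).factorial : ℚ) /
        (p.factorial * q.factorial * (x + 2 * i).factorial * (y + 2 * i).factorial) := by
  rw [detFactor, hs, hp, hq, ascPochhammer_eval_eq_div, ascPochhammer_eval_eq_div,
    Nat.add_sub_cancel]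
  field_simp

theorem detFactor_pos (x y i : ℕ) (h : 1 ≤ x + y) : 0 < detFactor x y i := by
  rw [detFactor_eq x y i (s := x + y + i - 1) (p := 2 * x + y + 2 * i - 1)
    (q := x + 2 * y + 2 * i - 1) (by omega) (by omega) (by omega)]
  positivity

theorem detFactor_sub_detFactor (x y k : ℕ) :
    detFactor (x + 1) (y + 1) k - detFactor x y (k + 1) =
      (x * y * (x + y) : ℚ) * (k.factorial * (x + y + k).factorial *
        (2 * x + y + 3 * k + 2).factorial * (x + 2 * y + 3 * k + 2).factorial) /
      ((2 * x + y + 2 * k + 2).factorial * (x + 2 * y + 2 * k + 2).factorial *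
        (x + 2 * k + 2).factorial * (y + 2 * k + 2).factorial) := by
  rw [detFactor_eq (x + 1) (y + 1) k (s := x + y + k + 1) (p := 2 * x + y + 2 * k + 2)
      (q := x + 2 * y + 2 * k + 2) (by ring) (by ring) (by ring),
    detFactor_eq x y (k + 1) (s := x + y + k) (p := 2 * x + y + 2 * k + 1)
      (q := x + 2 * y + 2 * k + 1) (by ring) (by ring) (by ring),
    show 2 * x + y + 2 * k + 2 + k = 2 * x + y + 3 * k + 2 by ring,
    show x + 2 * y + 2 * k + 2 + k = x + 2 * y + 3 * k + 2 by ring,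
    show 2 * x + y + 2 * k + 1 + (k + 1) = 2 * x + y + 3 * k + 2 by ring,
    show x + 2 * y + 2 * k + 1 + (k + 1) = x + 2 * y + 3 * k + 2 by ring,
    show x + 1 + 2 * k = x + 2 * k + 1 by ring, show y + 1 + 2 * k = y + 2 * k + 1 by ring,
    show x + 2 * (k + 1) = x + 2 * k + 2 by ring, show y + 2 * (k + 1) = y + 2 * k + 2 by ring]
  generalize (2 * x + y + 3 * k + 2).factorial = F
  generalize (x + 2 * y + 3 * k + 2).factorial = G
  simp only [Nat.factorial_succ]
  push_cast
  field_simp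
  ring

theorem detFactor_mul_detFactor (a b k : ℕ) :
    detFactor (a + 3) b (k + 1) * detFactor a (b + 3) (k + 1) *
        (detFactor (a + 1 + 1) (b + 1 + 1) k - detFactor (a + 1) (b + 1) (k + 1)) =
      (detFactor (a + 1 + 1) (b + 1 + 1) (k + 1) - detFactor (a + 1) (b + 1) (k + 2)) *
        detFactor (a + 1) (b + 1) (k + 1) * detFactor (a + 1 + 1) (b + 1 + 1) k := by
  rw [detFactor_sub_detFactor, detFactor_sub_detFactor,
    detFactor_eq (a + 3) b (k + 1) (s := a + b + k + 3) (p := 2 * a + b + 2 * k + 7)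
      (q := a + 2 * b + 2 * k + 4) (by ring) (by ring) (by ring),
    detFactor_eq a (b + 3) (k + 1) (s := a + b + k + 3) (p := 2 * a + b + 2 * k + 4)
      (q := a + 2 * b + 2 * k + 7) (by ring) (by ring) (by ring),
    detFactor_eq (a + 1) (b + 1) (k + 1) (s := a + b + k + 2) (p := 2 * a + b + 2 * k + 4)
      (q := a + 2 * b + 2 * k + 4) (by ring) (by ring) (by ring),
    detFactor_eq (a + 1 + 1) (b + 1 + 1) k (s := a + b + k + 3) (p := 2 * a + b + 2 * k + 5)
      (q := a + 2 * b + 2 * k + 5) (by ring) (by ring) (by ring)]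
  ring_nf

/-- Multiplied-out form of the Dodgson recurrence for `∏ i ∈ range n, detFactor x y i`. -/
theorem prod_detFactor_mul_prod_detFactor (a b k : ℕ) :
    (∏ i ∈ range (k + 1), detFactor (a + 3) b i) * ∏ i ∈ range (k + 1), detFactor a (b + 3) i =
      (detFactor (a + 1 + 1) (b + 1 + 1) k - detFactor (a + 1) (b + 1) (k + 1)) *
        (∏ i ∈ range (k + 1), detFactor (a + 1) (b + 1) i) *
        ∏ i ∈ range k, detFactor (a + 1 + 1) (b + 1 + 1) i := by
  induction k with
  | zero =>
    rw [detFactor_sub_detFactor]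
    simp only [zero_add, prod_range_one, prod_range_zero]
    rw [detFactor_eq (a + 3) b 0 (s := a + b + 2) (p := 2 * a + b + 5)
        (q := a + 2 * b + 2) (by ring) (by ring) (by ring),
      detFactor_eq a (b + 3) 0 (s := a + b + 2) (p := 2 * a + b + 2)
        (q := a + 2 * b + 5) (by ring) (by ring) (by ring),
      detFactor_eq (a + 1) (b + 1) 0 (s := a + b + 1) (p := 2 * a + b + 2)
        (q := a + 2 * b + 2) (by ring) (by ring) (by ring)]
    simp only [Nat.factorial_zero, mul_zero, add_zero]
    rw [show a + 1 + (b + 1) = a + b + 2 by ring,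
      show 2 * (a + 1) + (b + 1) = 2 * a + b + 3 by ring,
      show a + 1 + 2 * (b + 1) = a + 2 * b + 3 by ring]
    simp only [Nat.factorial_succ]
    push_cast
    field_simp
    ring
  | succ k ih =>
    have h := detFactor_mul_detFactor a b k
    rw [prod_range_succ _ (k + 1), prod_range_succ _ (k + 1),
      prod_range_succ (detFactor (a + 1) (b + 1)) (k + 1),
      prod_range_succ (detFactor (a + 1 + 1) (b + 1 + 1)) k]
    linear_combination (detFactor (a + 3) b (k + 1) * detFactor a (b + 3) (k + 1)) * ih +
      (∏ i ∈ range (k + 1), detFactor (a + 1) (b + 1) i) *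
        (∏ i ∈ range k, detFactor (a + 1 + 1) (b + 1 + 1) i) * h

theorem factorialMatrix_submatrix_castSucc_castSucc (x y n : ℕ) :
    (factorialMatrix x y (n + 1)).submatrix Fin.castSucc Fin.castSucc = factorialMatrix x y n := by
  ext i j
  simp [factorialMatrix]

theorem factorialMatrix_submatrix_succ_succ (x y n : ℕ) :
    (factorialMatrix x y (n + 1)).submatrix Fin.succ Fin.succ =
      factorialMatrix (x + 1) (y + 1) n := by
  ext i j
  simp only [factorialMatrix, Matrix.submatrix_apply, Matrix.of_apply, Fin.val_succ]
  congr 2 <;> [(congr 3; omega); (congr 1; push_cast; ring); (push_cast; ring)]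

theorem factorialMatrix_submatrix_succ_castSucc (x y n : ℕ) :
    (factorialMatrix x (y + 1) (n + 1)).submatrix Fin.succ Fin.castSucc =
      factorialMatrix (x + 2) y n := by
  ext i j
  simp only [factorialMatrix, Matrix.submatrix_apply, Matrix.of_apply, Fin.val_succ,
    Fin.val_castSucc]
  congr 2 <;> [(congr 3; omega); (congr 1; push_cast; ring); (push_cast; ring)]

theorem factorialMatrix_submatrix_castSucc_succ (x y n : ℕ) :
    (factorialMatrix (x + 1) y (n + 1)).submatrix Fin.castSucc Fin.succ =
      factorialMatrix x (y + 2) n := by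
  ext i j
  simp only [factorialMatrix, Matrix.submatrix_apply, Matrix.of_apply, Fin.val_succ,
    Fin.val_castSucc]
  congr 2 <;> [(congr 3; omega); (congr 1; push_cast; ring); (push_cast; ring)]

theorem invFactQ_of_neg {m : ℤ} (h : m < 0) : invFactQ m = 0 :=
  if_neg (not_le.mpr h)

theorem det_factorialMatrix_submatrix_succ_castSucc (x n : ℕ) :
    ((factorialMatrix x 0 (n + 2)).submatrix Fin.succ Fin.castSucc).det = 0 := by
  refine Matrix.det_eq_zero_of_column_eq_zero 0 fun i => ?_
  simp only [factorialMatrix, Matrix.submatrix_apply, Matrix.of_apply, Fin.val_succ]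
  rw [mul_eq_zero]
  right
  apply invFactQ_of_neg
  simp
  omega

theorem det_factorialMatrix_submatrix_castSucc_succ (y n : ℕ) :
    ((factorialMatrix 0 y (n + 2)).submatrix Fin.castSucc Fin.succ).det = 0 := by
  refine Matrix.det_eq_zero_of_row_eq_zero 0 fun j => ?_
  simp only [factorialMatrix, Matrix.submatrix_apply, Matrix.of_apply, Fin.val_succ]
  rw [mul_eq_zero, mul_eq_zero]
  left
  right
  apply invFactQ_of_neg
  simp
  omega

theorem det_factorialMatrix_one (x y : ℕ) :
    (factorialMatrix x y 1).det = ∏ i ∈ range 1, detFactor x y i := by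
  rw [Matrix.det_unique]
  simp [factorialMatrix, detFactor, invFactQ]
  field_simp

theorem det_factorialMatrix (n : ℕ) : ∀ x y : ℕ, 1 ≤ x + y →
    (factorialMatrix x y n).det = ∏ i ∈ range n, detFactor x y i := by
  induction n using Nat.strong_induction_on with
  | _ n ih =>
  intro x y hxy
  match n, ih with
  | 0, _ => simp
  | 1, _ => exact det_factorialMatrix_one x y
  | k + 2, ih =>
    have hP : ∏ i ∈ range k, detFactor (x + 1) (y + 1) i ≠ 0 :=
      (prod_pos fun i _ => detFactor_pos (x + 1) (y + 1) i (by omega)).ne'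
    have hcross : ((factorialMatrix x y (k + 2)).submatrix Fin.succ Fin.castSucc).det *
        ((factorialMatrix x y (k + 2)).submatrix Fin.castSucc Fin.succ).det =
        (detFactor (x + 1) (y + 1) k - detFactor x y (k + 1)) *
          (∏ i ∈ range (k + 1), detFactor x y i) * ∏ i ∈ range k, detFactor (x + 1) (y + 1) i := by
      rcases x with _ | a
      · rw [det_factorialMatrix_submatrix_castSucc_succ, detFactor_sub_detFactor]
        simp
      rcases y with _ | b
      · rw [det_factorialMatrix_submatrix_succ_castSucc, detFactor_sub_detFactor]
        simp
      rw [factorialMatrix_submatrix_succ_castSucc, factorialMatrix_submatrix_castSucc_succ,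
        ih (k + 1) (by omega) _ _ (by omega), ih (k + 1) (by omega) _ _ (by omega)]
      exact prod_detFactor_mul_prod_detFactor a b k
    have hD := Matrix.desnanot_jacobi (factorialMatrix x y (k + 2))
    have hmid : (factorialMatrix x y (k + 2)).submatrix (fun i : Fin k => i.castSucc.succ)
        (fun i : Fin k => i.castSucc.succ) = factorialMatrix (x + 1) (y + 1) k := by
      rw [← factorialMatrix_submatrix_castSucc_castSucc, ← factorialMatrix_submatrix_succ_succ]
      rfl
    rw [hcross, hmid, factorialMatrix_submatrix_castSucc_castSucc,
      factorialMatrix_submatrix_succ_succ, ih k (by omega) _ _ (by omega),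
      ih (k + 1) (by omega) _ _ (by omega), ih (k + 1) (by omega) _ _ (by omega),
      prod_range_succ (detFactor (x + 1) (y + 1)) k] at hD
    apply mul_right_cancel₀ hP
    rw [hD, prod_range_succ _ (k + 1)]
    ring

/-- Determinant evaluation (Theorem of [Krat, "Advanced Determinant Calculus",
eq. (3.42)]): for nonnegative integers `x, y, n` with `x + y ≥ 1`,
`det_{0≤i,j≤n−1}((x+y+i+j−1)!/((x+2i−j)!(y+2j−i)!))
 = ∏_{i=0}^{n−1} i!(x+y+i−1)!(2x+y+2i)_i(x+2y+2i)_i/((x+2i)!(y+2i)!)`,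
where an entry vanishes when `x+2i−j < 0` or `y+2j−i < 0`, and `(a)_k` is the
ascending Pochhammer symbol (`ascPochhammer`). -/
theorem stmt_16 (x y n : ℕ) (hxy : 1 ≤ x + y) :
    Matrix.det (Matrix.of fun i j : Fin n =>
        ((x + y + (i : ℕ) + (j : ℕ) - 1).factorial : ℚ) *
          invFactQ ((x : ℤ) + 2 * ((i : ℕ) : ℤ) - ((j : ℕ) : ℤ)) *
          invFactQ ((y : ℤ) + 2 * ((j : ℕ) : ℤ) - ((i : ℕ) : ℤ))) =
      ∏ i ∈ Finset.range n,
        ((i.factorial : ℚ) * ((x + y + i - 1).factorial : ℚ) *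
            (ascPochhammer ℚ i).eval ((2 * x + y + 2 * i : ℕ) : ℚ) *
            (ascPochhammer ℚ i).eval ((x + 2 * y + 2 * i : ℕ) : ℚ)) /
          (((x + 2 * i).factorial : ℚ) * ((y + 2 * i).factorial : ℚ)) := by
  exact det_factorialMatrix n x y hxy
end

section
/- Let n be a positive integer and let x and y be nonnegative integers. Then, as an identity of rational numbers, det_{1≤i,j≤n}( C(x+y+j, x−i+2j) − C(x+y+j, x+i+2j) ) = ∏_{j=1}^{n} ( (j−1)!·(x+y+2j)!·(x−y+2j+1)_j·(x+2y+3j+1)_{n−j} / ((x+n+2j)!·(y+n−j)!) ), where C(m, r) is the binomial coefficient with the convention C(m, r) = 0 whenever r < 0 or r > m, and (a)_k := a(a+1)···(a+k−1) with (a)_0 := 1 (here applied to integers a which may be computed in ℚ, e.g. (x−y+2j+1)_j with x−y an arbitrary integer). -/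
open Finset

/-- `binomIntQ m r` is the binomial coefficient `C(m, r)` (as a rational number)
for an integer lower index `r`, with `C(m, r) = 0` when `r < 0` (and `Nat.choose`
already vanishes when `r > m`). -/
def binomIntQ (m : ℕ) (r : ℤ) : ℚ :=
  if 0 ≤ r then (m.choose r.toNat : ℚ) else 0

namespace Matrix

/-- Jacobi's identity for a complementary minor of the adjugate. -/
theorem det_mul_det_adjugate_toBlocks₂₂ {m n R : Type*} [Fintype m] [DecidableEq m] [Fintype n]
    [DecidableEq n] [CommRing R] (A : Matrix (m ⊕ n) (m ⊕ n) R) :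
    A.det * A.adjugate.toBlocks₂₂.det = A.toBlocks₁₁.det * A.det ^ Fintype.card n := by
  have key : A * fromBlocks 1 A.adjugate.toBlocks₁₂ 0 A.adjugate.toBlocks₂₂ =
      fromBlocks A.toBlocks₁₁ 0 A.toBlocks₂₁ (A.det • 1) := by
    have h := mul_adjugate A
    rw [← fromBlocks_toBlocks A.adjugate, ← fromBlocks_toBlocks A, fromBlocks_multiply,
      ← fromBlocks_one, fromBlocks_smul, fromBlocks_inj, fromBlocks_toBlocks] at h
    obtain ⟨-, h12, -, h22⟩ := h
    nth_rw 1 [← fromBlocks_toBlocks A]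
    rw [fromBlocks_multiply, h12, h22]
    simp
  have h := congrArg det key
  rw [det_mul, det_fromBlocks_zero₂₁, det_fromBlocks_zero₁₂, det_smul] at h
  simpa using h

/-- The Desnanot–Jacobi identity (Dodgson condensation). -/
theorem det_mul_det_interior {R : Type*} [CommRing R] {n : ℕ}
    (A : Matrix (Fin (n + 2)) (Fin (n + 2)) R) :
    A.det * (A.submatrix (fun i : Fin n => i.succ.castSucc) fun j => j.succ.castSucc).det =
      (A.submatrix Fin.castSucc Fin.castSucc).det * (A.submatrix Fin.succ Fin.succ).det -
        (A.submatrix Fin.succ Fin.castSucc).det * (A.submatrix Fin.castSucc Fin.succ).det := by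
  suffices H : A.det * (A.submatrix (fun i : Fin n => i.succ.castSucc)
      fun j => j.succ.castSucc).det =
      A.adjugate 0 0 * A.adjugate (Fin.last _) (Fin.last _) -
        A.adjugate 0 (Fin.last _) * A.adjugate (Fin.last _) 0 by
    have e : ((-1 : R) ^ (n + 1)) * (-1) ^ (n + 1) = 1 := by
      rw [← mul_pow]; simp
    have e2 : ((-1 : R) ^ (n + 1 + (n + 1))) = 1 := by rw [pow_add, e]
    rw [H]
    simp only [adjugate_fin_succ_eq_det_submatrix, Fin.succAbove_last, Fin.succAbove_zero,
      Fin.val_zero, Fin.val_last, add_zero, zero_add, pow_zero, one_mul, e2]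
    linear_combination -(A.submatrix Fin.succ Fin.castSucc).det *
      (A.submatrix Fin.castSucc Fin.succ).det * e
  have hinj : Function.Injective
      (Sum.elim (fun i : Fin n => i.succ.castSucc) ![0, Fin.last (n + 1)]) := by
    rintro (i | i) (j | j) h
    · simpa using h
    · fin_cases j
      · simp [Fin.ext_iff] at h
      · simp [Fin.ext_iff] at h
        lia
    · fin_cases i
      · simp [Fin.ext_iff] at h
      · simp [Fin.ext_iff] at h
        lia
    · fin_cases i <;> fin_cases j <;> simp [Fin.ext_iff] at h ⊢
  let e : Fin n ⊕ Fin 2 ≃ Fin (n + 2) := Equiv.ofBijective _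
    ((Fintype.bijective_iff_injective_and_card _).2 ⟨hinj, by simp⟩)
  let X := mvPolynomialX (Fin (n + 2)) (Fin (n + 2)) ℤ
  have hX : X.det * (X.submatrix (fun i : Fin n => i.succ.castSucc)
      fun j => j.succ.castSucc).det =
      X.adjugate 0 0 * X.adjugate (Fin.last _) (Fin.last _) -
        X.adjugate 0 (Fin.last _) * X.adjugate (Fin.last _) 0 := by
    have h := det_mul_det_adjugate_toBlocks₂₂ (X.submatrix e e)
    rw [adjugate_submatrix_equiv_self, det_submatrix_equiv_self, det_fin_two,
      Fintype.card_fin] at h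
    refine mul_left_cancel₀ (det_mvPolynomialX_ne_zero (Fin (n + 2)) ℤ) ?_
    change X.det * (X.adjugate 0 0 * X.adjugate (Fin.last _) (Fin.last _) -
        X.adjugate 0 (Fin.last _) * X.adjugate (Fin.last _) 0) =
      (X.submatrix (fun i : Fin n => i.succ.castSucc) fun j => j.succ.castSucc).det *
        X.det ^ 2 at h
    change X.det * _ = X.det * _
    rw [h]
    ring
  let f : MvPolynomial (Fin (n + 2) × Fin (n + 2)) ℤ →+* R :=
    (MvPolynomial.aeval fun p : Fin (n + 2) × Fin (n + 2) => A p.1 p.2).toRingHom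
  have hA : f.mapMatrix X = A := mvPolynomialX_mapMatrix_aeval ℤ A
  have h := congrArg f hX
  have hadj (i j) : f (X.adjugate i j) = A.adjugate i j := by
    rw [← hA, ← RingHom.map_adjugate]; rfl
  have hdet : f X.det = A.det := by rw [RingHom.map_det, hA]
  simp only [map_mul, map_sub, hadj, hdet] at h
  rw [← h, RingHom.map_det]
  congr 2
  nth_rw 1 [← hA]
  rfl

end Matrix

theorem binomIntQ_add_one (m : ℕ) (r : ℤ) :
    binomIntQ (m + 1) (r + 1) = binomIntQ m r + binomIntQ m (r + 1) := by
  unfold binomIntQ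
  rcases lt_trichotomy r (-1) with h | rfl | h
  · simp [show ¬ 0 ≤ r by lia, show ¬ 0 ≤ r + 1 by lia]
  · simp
  · lift r to ℕ using by lia
    simp only [show (0 : ℤ) ≤ r by lia, show (0 : ℤ) ≤ r + 1 by lia, if_true]
    norm_cast

/-- The difference of binomial coefficients `C(m, r - k) - C(m, r + k)`. -/
def binomDiff (m : ℕ) (r k : ℤ) : ℚ := binomIntQ m (r - k) - binomIntQ m (r + k)

theorem binomDiff_zero (m : ℕ) (r : ℤ) : binomDiff m r 0 = 0 := by simp [binomDiff]

theorem binomDiff_add_two (m : ℕ) (r k : ℤ) :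
    binomDiff (m + 2) (r + 1) k =
      binomDiff m r (k - 1) + 2 * binomDiff m r k + binomDiff m r (k + 1) := by
  have H (s : ℤ) : binomIntQ (m + 2) (s + 1) =
      binomIntQ m (s - 1) + 2 * binomIntQ m s + binomIntQ m (s + 1) := by
    have h₁ := binomIntQ_add_one (m + 1) s
    have h₂ := binomIntQ_add_one m (s - 1)
    have h₃ := binomIntQ_add_one m s
    rw [sub_add_cancel] at h₂
    linear_combination h₁ + h₂ + h₃
  have h₁ := H (r - k)
  have h₂ := H (r + k)
  simp only [binomDiff]
  rw [show r + 1 - k = r - k + 1 by ring, show r + 1 + k = r + k + 1 by ring,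
    show r - (k - 1) = r - k + 1 by ring, show r + (k - 1) = r + k - 1 by ring,
    show r - (k + 1) = r - k - 1 by ring, show r + (k + 1) = r + k + 1 by ring]
  linear_combination h₁ - h₂

/-- The coefficients expressing `(z - z⁻¹) (z + 2 + z⁻¹) ^ i` in terms of the Laurent polynomials
`z ^ (k + 1) - z ^ (-(k + 1))`. -/
def ballotCoeff : ℕ → ℕ → ℚ
  | 0, 0 => 1
  | 0, _ + 1 => 0
  | i + 1, 0 => 2 * ballotCoeff i 0 + ballotCoeff i 1
  | i + 1, k + 1 => ballotCoeff i k + 2 * ballotCoeff i (k + 1) + ballotCoeff i (k + 2)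

theorem ballotCoeff_eq_zero {i k : ℕ} (h : i < k) : ballotCoeff i k = 0 := by
  induction i generalizing k with
  | zero => obtain ⟨k, rfl⟩ := Nat.exists_eq_succ_of_ne_zero h.ne'; rfl
  | succ i ih =>
    obtain ⟨k, rfl⟩ := Nat.exists_eq_succ_of_ne_zero (Nat.ne_zero_of_lt h)
    simp [ballotCoeff, ih (show i < k by lia), ih (show i < k + 1 by lia),
      ih (show i < k + 2 by lia)]

theorem ballotCoeff_self (i : ℕ) : ballotCoeff i i = 1 := by
  induction i with
  | zero => rfl
  | succ i ih =>
    simp [ballotCoeff, ih, ballotCoeff_eq_zero (show i < i + 1 by lia),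
      ballotCoeff_eq_zero (show i < i + 2 by lia)]

theorem sum_ballotCoeff_mul_binomDiff {n i : ℕ} (h : i < n) (m : ℕ) (r : ℤ) :
    ∑ k ∈ range n, ballotCoeff i k * binomDiff m r (k + 1) =
      binomDiff (m + 2 * i) (r + i) 1 := by
  induction i generalizing m r with
  | zero =>
    rw [sum_eq_single_of_mem 0 (by simpa using h)]
    · simp [ballotCoeff]
    · intro k _ hk
      simp [ballotCoeff_eq_zero (Nat.pos_of_ne_zero hk)]
  | succ i ih =>
    obtain ⟨n, rfl⟩ := Nat.exists_eq_succ_of_ne_zero (Nat.ne_zero_of_lt h)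
    have h₁ := ih (by lia) (m + 2) (r + 1)
    rw [show m + 2 * (i + 1) = m + 2 + 2 * i by ring,
      show r + ((i + 1 : ℕ) : ℤ) = r + 1 + i by push_cast; ring, ← h₁]
    simp only [binomDiff_add_two, mul_add, sum_add_distrib, add_sub_cancel_right]
    rw [sum_range_succ' (fun k : ℕ => ballotCoeff i k * binomDiff m r k),
      sum_range_succ (fun k : ℕ => ballotCoeff i k * binomDiff m r (k + 1 + 1)),
      sum_range_succ' (fun k : ℕ => ballotCoeff i k * (2 * binomDiff m r (k + 1))),
      sum_range_succ', ballotCoeff_eq_zero (show i < n by lia)]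
    have h₂ : ∑ k ∈ range n, ballotCoeff i (k + 1) * binomDiff m r (k + 1) =
        ∑ k ∈ range n, ballotCoeff i (k + 2) * binomDiff m r (k + 2) +
          ballotCoeff i 1 * binomDiff m r 1 := by
      have := sum_range_succ' (fun k : ℕ => ballotCoeff i (k + 1) * binomDiff m r (k + 1)) n
      rw [sum_range_succ, ballotCoeff_eq_zero (show i < n + 1 by lia)] at this
      simpa [add_assoc, one_add_one_eq_two] using this
    push_cast
    rw [h₂]
    simp only [ballotCoeff, add_mul, sum_add_distrib, binomDiff_zero]
    simp only [add_assoc, one_add_one_eq_two, mul_zero, zero_mul, add_zero]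
    simp only [← mul_assoc, mul_comm _ (2 : ℚ)]
    ring

theorem det_binomDiff (n : ℕ) (m : ℕ → ℕ) (r : ℕ → ℤ) :
    Matrix.det (Matrix.of fun i j : Fin n => binomDiff (m j) (r j) ((i : ℕ) + 1)) =
      Matrix.det (Matrix.of fun i j : Fin n => binomDiff (m j + 2 * i) (r j + (i : ℕ)) 1) := by
  let L : Matrix (Fin n) (Fin n) ℚ := Matrix.of fun i k => ballotCoeff i k
  have hL : L.det = 1 := by
    rw [Matrix.det_of_isLowerTriangular]
    · simp [L, ballotCoeff_self]
    · intro i k hik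
      exact ballotCoeff_eq_zero hik
  rw [← one_mul (Matrix.det _), ← hL, ← Matrix.det_mul]
  congr 1
  ext i j
  simp only [Matrix.mul_apply, L, Matrix.of_apply]
  rw [← sum_ballotCoeff_mul_binomDiff i.2,
    ← Fin.sum_univ_eq_sum_range (fun k : ℕ => ballotCoeff i k * binomDiff (m j) (r j) (k + 1))]

open Complex

/-- The matrix entry `(x + y + j + 2i + 2)! / ((x + 2j + i + 3)! (y - j + i)!)` with complex
parameters. -/
noncomputable def gammaEntry (x y : ℂ) (i j : ℕ) : ℂ :=
  Gamma (x + y + j + 2 * i + 3) * (Gamma (x + 2 * j + i + 4))⁻¹ * (Gamma (y - j + i + 1))⁻¹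

/-- The determinant of the `n × n` matrix with entries `gammaEntry x y i j`. -/
noncomputable def gammaDet (n : ℕ) (x y : ℂ) : ℂ :=
  Matrix.det (Matrix.of fun i j : Fin n => gammaEntry x y i j)

/-- The factor with index `j` in the evaluation of `gammaDet n x y`. -/
noncomputable def gammaFactor (n : ℕ) (x y : ℂ) (j : ℕ) : ℂ :=
  (j.factorial : ℂ) * Gamma (x + y + 2 * j + 3) * (ascPochhammer ℂ j).eval (x - y + 2 * j + 3) *
    (ascPochhammer ℂ (n - 1 - j)).eval (x + 2 * y + 3 * j + 4) *
    (Gamma (x + n + 2 * j + 3))⁻¹ * (Gamma (y + n - j))⁻¹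

/-- Complex parameters for which no linear form occurring in the evaluation of `gammaDet`
vanishes. -/
def IsGenericPair (x y : ℂ) : Prop :=
  ∀ k : ℤ, x + k ≠ 0 ∧ y + k ≠ 0 ∧ x + y + k ≠ 0 ∧ x - y + k ≠ 0 ∧ x + 2 * y + k ≠ 0

theorem IsGenericPair.add_intCast {x y : ℂ} (h : IsGenericPair x y) (a b : ℤ) :
    IsGenericPair (x + a) (y + b) := by
  intro k
  refine ⟨?_, ?_, ?_, ?_, ?_⟩
  · convert (h (a + k)).1 using 1
    push_cast; ring
  · convert (h (b + k)).2.1 using 1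
    push_cast; ring
  · convert (h (a + b + k)).2.2.1 using 1
    push_cast; ring
  · convert (h (a - b + k)).2.2.2.1 using 1
    push_cast; ring
  · convert (h (a + 2 * b + k)).2.2.2.2 using 1
    push_cast; ring

theorem Gamma_ne_zero_of_add_intCast {s : ℂ} (h : ∀ k : ℤ, s + k ≠ 0) (k : ℤ) :
    Gamma (s + k) ≠ 0 := by
  refine Complex.Gamma_ne_zero fun m hm => h (k + m) ?_
  push_cast
  linear_combination hm

theorem ascPochhammer_eval_ne_zero {s : ℂ} (h : ∀ k : ℤ, s + k ≠ 0) (n : ℕ) (k : ℤ) :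
    (ascPochhammer ℂ n).eval (s + k) ≠ 0 := by
  induction n with
  | zero => simp
  | succ n ih =>
    rw [ascPochhammer_succ_eval]
    refine mul_ne_zero ih ?_
    have := h (k + n)
    push_cast at this
    rwa [← add_assoc] at this

theorem ascPochhammer_succ_eval' {R : Type*} [CommSemiring R] (n : ℕ) (a : R) :
    (ascPochhammer R (n + 1)).eval a = a * (ascPochhammer R n).eval (a + 1) := by
  simp [ascPochhammer_succ_left, Polynomial.eval_comp]

theorem IsGenericPair.gammaFactor_ne_zero {x y : ℂ} (h : IsGenericPair x y) (n j : ℕ) :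
    gammaFactor n x y j ≠ 0 := by
  have h₁ := Gamma_ne_zero_of_add_intCast (fun k => (h k).2.2.1) (2 * j + 3)
  have h₂ := ascPochhammer_eval_ne_zero (fun k => (h k).2.2.2.1) j (2 * j + 3)
  have h₃ := ascPochhammer_eval_ne_zero (fun k => (h k).2.2.2.2) (n - 1 - j) (3 * j + 4)
  have h₄ := Gamma_ne_zero_of_add_intCast (fun k => (h k).1) (n + 2 * j + 3)
  have h₅ := Gamma_ne_zero_of_add_intCast (fun k => (h k).2.1) (n - j)
  push_cast [← add_assoc, ← add_sub_assoc] at h₁ h₂ h₃ h₄ h₅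
  have h₆ : (j.factorial : ℂ) ≠ 0 := by exact_mod_cast j.factorial_ne_zero
  simp only [gammaFactor]
  positivity

theorem gammaDet_condensation (n : ℕ) (x y : ℂ) :
    gammaDet (n + 2) x y * gammaDet n (x + 3) y =
      gammaDet (n + 1) x y * gammaDet (n + 1) (x + 3) y -
        gammaDet (n + 1) (x + 1) (y + 1) * gammaDet (n + 1) (x + 2) (y - 1) := by
  have h := Matrix.det_mul_det_interior
    (Matrix.of fun i j : Fin (n + 2) => gammaEntry x y i j)
  simp only [gammaDet]
  convert h using 3
  all_goals
    try congr 1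
    try ext i j
    try simp only [Matrix.of_apply, Matrix.submatrix_apply, gammaEntry, Fin.val_succ,
      Fin.val_castSucc]
    try push_cast
    try ring_nf

/-- The ratio of consecutive products of the factors `gammaFactor`. -/
theorem prod_gammaFactor_succ {x y : ℂ} (h : IsGenericPair x y) (n : ℕ) :
    (∏ j ∈ range (n + 1), gammaFactor (n + 1) x y j) *
        (∏ j ∈ range n, (x + n + 2 * j + 3)) * (∏ j ∈ range n, (y + n - j)) =
      (∏ j ∈ range n, gammaFactor n x y j) * (∏ j ∈ range n, (x + 2 * y + n + 3 + 2 * j)) *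
        ((n.factorial : ℂ) * Gamma (x + y + 2 * n + 3) *
          (ascPochhammer ℂ n).eval (x - y + 2 * n + 3) *
          (Gamma (x + 3 * n + 4))⁻¹ * (Gamma (y + 1))⁻¹) := by
  rw [prod_range_succ, mul_right_comm, mul_right_comm (∏ j ∈ range n, gammaFactor (n + 1) x y j),
    ← prod_mul_distrib, mul_right_comm, ← prod_mul_distrib, ← prod_mul_distrib]
  congr 1
  · refine prod_congr rfl fun j hj => ?_
    obtain ⟨m, rfl⟩ := Nat.exists_eq_add_of_lt (mem_range.1 hj)
    have hx := (h (j + m + 1 + 2 * j + 3)).1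
    have hy := (h (m + 1)).2.1
    push_cast [← add_assoc] at hx hy
    simp only [gammaFactor, show j + m + 1 + 1 - 1 - j = m + 1 by lia,
      show j + m + 1 - 1 - j = m by lia]
    push_cast
    rw [show x + (j + m + 1 + 1) + 2 * j + 3 = (x + (j + m + 1) + 2 * j + 3) + 1 by ring,
      show y + (j + m + 1 + 1) - j = (y + (j + m + 1) - j) + 1 by ring,
      Gamma_add_one _ (by convert hx using 1; ring),
      Gamma_add_one _ (by convert hy using 1; ring), ascPochhammer_succ_eval, mul_inv, mul_inv]
    have hx' : x + (j + m + 1) + 2 * j + 3 ≠ 0 := by convert hx using 1; ring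
    have hy' : y + (j + m + 1) - j ≠ 0 := by convert hy using 1; ring
    field_simp
    ring
  · simp only [gammaFactor]
    push_cast
    simp
    ring_nf

theorem prod_gammaFactor_interior {x y : ℂ} (h : IsGenericPair x y) (n : ℕ) :
    (∏ j ∈ range (n + 2), gammaFactor (n + 2) x y j) *
        (∏ j ∈ range n, gammaFactor n (x + 3) y j) *
        ((x + y + 2 * n + 5) * (y + n + 1) * (x + n + 4)) =
      (n + 1) * (x - y + 2 * n + 5) * (x + 2 * y + n + 4) *
        ((∏ j ∈ range (n + 1), gammaFactor (n + 1) x y j) *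
          ∏ j ∈ range (n + 1), gammaFactor (n + 1) (x + 3) y j) := by
  have h₁ := prod_gammaFactor_succ h (n + 1)
  have h₂ := prod_gammaFactor_succ (h.add_intCast 3 0) n
  push_cast at h₁ h₂
  rw [add_zero] at h₂
  rw [prod_range_succ' (fun j : ℕ => (x + (n + 1) + 2 * (j : ℂ) + 3)),
    prod_range_succ' (fun j : ℕ => (y + (n + 1) - (j : ℂ))),
    prod_range_succ' (fun j : ℕ => (x + 2 * y + (n + 1) + 3 + 2 * (j : ℂ)))] at h₁
  have e₁ : ∏ j ∈ range n, (x + (n + 1) + 2 * ((j + 1 : ℕ) : ℂ) + 3) =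
      ∏ j ∈ range n, (x + 3 + n + 2 * (j : ℂ) + 3) :=
    prod_congr rfl fun j _ => by push_cast; ring
  have e₂ : ∏ j ∈ range n, (y + (n + 1) - ((j + 1 : ℕ) : ℂ)) =
      ∏ j ∈ range n, (y + n - (j : ℂ)) := prod_congr rfl fun j _ => by push_cast; ring
  have e₃ : ∏ j ∈ range n, (x + 2 * y + (n + 1) + 3 + 2 * ((j + 1 : ℕ) : ℂ)) =
      ∏ j ∈ range n, (x + 3 + 2 * y + n + 3 + 2 * (j : ℂ)) :=
    prod_congr rfl fun j _ => by push_cast; ring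
  have hG : Gamma (x + 3 + y + 2 * n + 3) =
      (x + y + 2 * n + 5) * Gamma (x + y + 2 * (n + 1) + 3) := by
    have := (h (2 * n + 5)).2.2.1
    push_cast [← add_assoc] at this
    rw [show x + y + 2 * (n + 1) + 3 = x + y + 2 * n + 5 by ring, ← Gamma_add_one _ this]
    ring_nf
  rw [e₁, e₂, e₃, ascPochhammer_succ_eval', Nat.factorial_succ,
    show x + 3 * ((n : ℂ) + 1) + 4 = x + 3 + 3 * n + 4 by ring,
    show x - y + 2 * ((n : ℂ) + 1) + 3 + 1 = x + 3 - y + 2 * n + 3 by ring] at h₁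
  rw [hG] at h₂
  have hX : ∏ j ∈ range n, (x + 3 + n + 2 * (j : ℂ) + 3) ≠ 0 := by
    refine prod_ne_zero_iff.2 fun j _ => ?_
    convert (h (3 + n + 2 * j + 3)).1 using 1
    push_cast; ring
  have hY : ∏ j ∈ range n, (y + n - (j : ℂ)) ≠ 0 := by
    refine prod_ne_zero_iff.2 fun j _ => ?_
    convert (h (n - j)).2.1 using 1
    push_cast; ring
  refine mul_right_cancel₀ (mul_ne_zero hX hY) ?_
  push_cast at h₁ h₂ ⊢
  linear_combination (x + y + 2 * n + 5) * (∏ j ∈ range n, gammaFactor n (x + 3) y j) * h₁ -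
    (n + 1) * (x - y + 2 * n + 5) * (x + 2 * y + n + 4) *
      (∏ j ∈ range (n + 1), gammaFactor (n + 1) x y j) * h₂

theorem Gamma_add_two_mul_Gamma_add_one {s : ℂ} (h₀ : s ≠ 0) (h₁ : s + 1 ≠ 0) (h₂ : s + 2 ≠ 0) :
    Gamma (s + 2) * Gamma (s + 1) * (s + 2) = s * (Gamma s * Gamma (s + 3)) := by
  have e₂ := Gamma_add_one _ h₁
  have e₃ := Gamma_add_one _ h₂
  rw [show s + 1 + 1 = s + 2 by ring] at e₂
  rw [show s + 2 + 1 = s + 3 by ring] at e₃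
  rw [e₃, Gamma_add_one s h₀]
  ring

theorem prod_gammaFactor_shift {x y : ℂ} (h : IsGenericPair x y) (n : ℕ) :
    (∏ j ∈ range n, gammaFactor n (x + 1) (y + 1) j) *
        (∏ j ∈ range n, gammaFactor n (x + 2) (y - 1) j) *
        ((x + y + 2 * n + 3) * (y + n) * (x + n + 3)) =
      (x + y + 3) * (x + 3 * n + 3) * y *
        ((∏ j ∈ range n, gammaFactor n x y j) * ∏ j ∈ range n, gammaFactor n (x + 3) y j) := by
  have hs (k : ℕ) : x + y + 2 * k + 3 ≠ 0 := by
    convert (h (2 * k + 3)).2.2.1 using 1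
    push_cast; ring
  have hu (k : ℕ) : x + n + 2 * k + 3 ≠ 0 := by
    convert (h (n + 2 * k + 3)).1 using 1
    push_cast; ring
  have hw (k : ℕ) : y + n - k ≠ 0 := by
    convert (h (n - k)).2.1 using 1
    push_cast; ring
  have key (j : ℕ) : gammaFactor n (x + 1) (y + 1) j * gammaFactor n (x + 2) (y - 1) j *
      ((x + y + 2 * (j + 1 : ℕ) + 3) * (y + n - j) * (x + n + 2 * j + 3)) =
      (x + y + 2 * j + 3) * (y + n - (j + 1 : ℕ)) * (x + n + 2 * (j + 1 : ℕ) + 3) *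
        (gammaFactor n x y j * gammaFactor n (x + 3) y j) := by
    have hs' := (h (2 * j + 4)).2.2.1
    have hu' := (h (n + 2 * j + 4)).1
    have hs'' := hs (j + 1)
    have hu'' := hu (j + 1)
    have hw' := hw (j + 1)
    push_cast [← add_assoc] at hs' hu' hs'' hu'' hw'
    have es := Gamma_add_two_mul_Gamma_add_one (hs j) (by convert hs' using 1; ring)
      (by convert hs'' using 1; ring)
    have eΓ := Gamma_add_two_mul_Gamma_add_one (hu j) (by convert hu' using 1; ring)
      (by convert hu'' using 1; ring)
    have eu' := congrArg (·⁻¹) eΓ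
    have ew₁ := Gamma_add_one _ (hw j)
    have ew₂ := Gamma_add_one _ hw'
    rw [show y + n - ((j : ℂ) + 1) + 1 = y + n - j by ring] at ew₂
    have eu : (Gamma (x + n + 2 * j + 3 + 1))⁻¹ * (Gamma (x + n + 2 * j + 3 + 2))⁻¹ *
        (x + n + 2 * j + 3) = (x + n + 2 * j + 3 + 2) *
          ((Gamma (x + n + 2 * j + 3))⁻¹ * (Gamma (x + n + 2 * j + 3 + 3))⁻¹) := by
      have hu3 : x + n + 2 * j + 3 + 2 ≠ 0 := by convert hu'' using 1; ring
      simp only [mul_inv] at eu'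
      field_simp [hu j] at eu' ⊢
      linear_combination eu'
    have ew : (Gamma (y + n - j + 1))⁻¹ * (Gamma (y + n - (j + 1)))⁻¹ * (y + n - j) =
        (y + n - (j + 1)) * ((Gamma (y + n - j))⁻¹ * (Gamma (y + n - j))⁻¹) := by
      have hwj := hw j
      rw [ew₁, ew₂]
      field_simp
    simp only [gammaFactor]
    push_cast
    rw [show x + 1 + (y + 1) + 2 * (j : ℂ) + 3 = x + y + 2 * j + 3 + 2 by ring,
      show x + 2 + (y - 1) + 2 * (j : ℂ) + 3 = x + y + 2 * j + 3 + 1 by ring,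
      show x + 3 + y + 2 * (j : ℂ) + 3 = x + y + 2 * j + 3 + 3 by ring,
      show x + 1 + n + 2 * (j : ℂ) + 3 = x + n + 2 * j + 3 + 1 by ring,
      show x + 2 + n + 2 * (j : ℂ) + 3 = x + n + 2 * j + 3 + 2 by ring,
      show x + 3 + n + 2 * (j : ℂ) + 3 = x + n + 2 * j + 3 + 3 by ring,
      show y + 1 + n - (j : ℂ) = y + n - j + 1 by ring,
      show y - 1 + n - (j : ℂ) = y + n - (j + 1) by ring,
      show x + 1 - (y + 1) + 2 * (j : ℂ) + 3 = x - y + 2 * j + 3 by ring,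
      show x + 2 - (y - 1) + 2 * (j : ℂ) + 3 = x + 3 - y + 2 * j + 3 by ring,
      show x + 1 + 2 * (y + 1) + 3 * (j : ℂ) + 4 = x + 3 + 2 * y + 3 * j + 4 by ring,
      show x + 2 + 2 * (y - 1) + 3 * (j : ℂ) + 4 = x + 2 * y + 3 * j + 4 by ring,
      show x + y + 2 * ((j : ℂ) + 1) + 3 = x + y + 2 * j + 3 + 2 by ring,
      show x + n + 2 * ((j : ℂ) + 1) + 3 = x + n + 2 * j + 3 + 2 by ring]
    generalize (ascPochhammer ℂ j).eval (x - y + 2 * j + 3) = p₁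
    generalize (ascPochhammer ℂ j).eval (x + 3 - y + 2 * j + 3) = p₂
    generalize (ascPochhammer ℂ (n - 1 - j)).eval (x + 3 + 2 * y + 3 * j + 4) = p₃
    generalize (ascPochhammer ℂ (n - 1 - j)).eval (x + 2 * y + 3 * j + 4) = p₄
    have hmul := congrArg₂ (· * ·) es (congrArg₂ (· * ·) eu ew)
    linear_combination (j.factorial : ℂ) ^ 2 * p₁ * p₂ * p₃ * p₄ * hmul
  have hprod : (∏ j ∈ range n, gammaFactor n (x + 1) (y + 1) j) *
        (∏ j ∈ range n, gammaFactor n (x + 2) (y - 1) j) *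
      ((∏ j ∈ range n, (x + y + 2 * (j + 1 : ℕ) + 3)) * (∏ j ∈ range n, (y + n - j)) *
        ∏ j ∈ range n, (x + n + 2 * j + 3)) =
      (∏ j ∈ range n, (x + y + 2 * j + 3)) * (∏ j ∈ range n, (y + n - (j + 1 : ℕ))) *
        (∏ j ∈ range n, (x + n + 2 * (j + 1 : ℕ) + 3)) *
        ((∏ j ∈ range n, gammaFactor n x y j) * ∏ j ∈ range n, gammaFactor n (x + 3) y j) := by
    simp only [← prod_mul_distrib]
    exact prod_congr rfl fun j _ => key j
  have t₁ := (prod_range_succ' (fun j : ℕ => x + y + 2 * (j : ℂ) + 3) n).symm.trans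
    (prod_range_succ _ n)
  have t₂ := (prod_range_succ' (fun j : ℕ => x + n + 2 * (j : ℂ) + 3) n).symm.trans
    (prod_range_succ _ n)
  have t₃ := (prod_range_succ' (fun j : ℕ => y + n - (j : ℂ)) n).symm.trans
    (prod_range_succ _ n)
  have n₁ : ∏ j ∈ range n, (x + y + 2 * (j : ℂ) + 3) ≠ 0 :=
    prod_ne_zero_iff.2 fun j _ => hs j
  have n₂ : ∏ j ∈ range n, (x + n + 2 * ((j + 1 : ℕ) : ℂ) + 3) ≠ 0 :=
    prod_ne_zero_iff.2 fun j _ => hu (j + 1)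
  have n₃ : ∏ j ∈ range n, (y + n - ((j + 1 : ℕ) : ℂ)) ≠ 0 :=
    prod_ne_zero_iff.2 fun j _ => hw (j + 1)
  refine mul_left_cancel₀ (mul_ne_zero (mul_ne_zero n₁ n₂) n₃) ?_
  generalize (∏ j ∈ range n, gammaFactor n (x + 1) (y + 1) j) *
        (∏ j ∈ range n, gammaFactor n (x + 2) (y - 1) j) = P at *
  generalize (∏ j ∈ range n, gammaFactor n x y j) *
    ∏ j ∈ range n, gammaFactor n (x + 3) y j = Q at *
  push_cast at *
  linear_combination (x + y + 3) * (x + 3 * n + 3) * y * hprod -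
    P * ((∏ j ∈ range n, (x + n + 2 * ((j : ℂ) + 1) + 3)) * (x + n + 3)) *
      ((∏ j ∈ range n, (y + n - ((j : ℂ) + 1))) * (y + n)) * t₁ +
    P * ((∏ j ∈ range n, (x + y + 2 * ((j : ℂ) + 1) + 3)) * (x + y + 3)) *
      ((∏ j ∈ range n, (y + n - ((j : ℂ) + 1))) * (y + n)) * t₂ +
    P * ((∏ j ∈ range n, (x + y + 2 * ((j : ℂ) + 1) + 3)) * (x + y + 3)) *
      ((∏ j ∈ range n, (x + n + 2 * (j : ℂ) + 3)) * (x + 3 * n + 3)) * t₃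

theorem gammaDet_eq_of_isGenericPair (n : ℕ) {x y : ℂ} (h : IsGenericPair x y) :
    gammaDet n x y = ∏ j ∈ range n, gammaFactor n x y j := by
  induction n using Nat.twoStepInduction generalizing x y with
  | zero => simp [gammaDet]
  | one =>
    simp only [gammaDet, gammaFactor, gammaEntry, Matrix.det_fin_one, Matrix.of_apply]
    simp [show x + 1 + 3 = x + 4 by ring]
  | more n ih₀ ih₁ =>
    have h30 := h.add_intCast 3 0
    have h11 := h.add_intCast 1 1
    have h21 := h.add_intCast 2 (-1)
    push_cast [add_zero, ← sub_eq_add_neg] at h30 h11 h21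
    have hc := gammaDet_condensation n x y
    rw [ih₀ h30, ih₁ h, ih₁ h30, ih₁ h11, ih₁ h21] at hc
    have k₁ := prod_gammaFactor_interior h n
    have k₂ := prod_gammaFactor_shift h (n + 1)
    have hP : ∏ j ∈ range n, gammaFactor n (x + 3) y j ≠ 0 :=
      prod_ne_zero_iff.2 fun j _ => h30.gammaFactor_ne_zero n j
    have d₁ := (h (2 * n + 5)).2.2.1
    have d₂ := (h (n + 1)).2.1
    have d₃ := (h (n + 4)).1
    push_cast [← add_assoc] at d₁ d₂ d₃ k₂
    refine mul_right_cancel₀ (mul_ne_zero hP (mul_ne_zero (mul_ne_zero d₁ d₂) d₃)) ?_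
    linear_combination (x + y + 2 * n + 5) * (y + n + 1) * (x + n + 4) * hc - k₁ - k₂

theorem continuous_inv_Gamma_comp {f : ℂ → ℂ} (hf : Continuous f) :
    Continuous fun t => (Gamma (f t))⁻¹ :=
  differentiable_one_div_Gamma.continuous.comp hf

theorem continuousAt_Gamma_comp {f : ℂ → ℂ} (hf : Continuous f) {t : ℂ} (ht : 0 < (f t).re) :
    ContinuousAt (fun t => Gamma (f t)) t := by
  refine ContinuousAt.comp (g := Gamma) (differentiableAt_Gamma _ fun m hm => ?_).continuousAt
    hf.continuousAt
  have := congrArg re hm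
  simp at this
  have : (0 : ℝ) ≤ m := m.cast_nonneg
  linarith

theorem continuousAt_gammaDet (n x y : ℕ) :
    ContinuousAt (fun t : ℂ => gammaDet n (x + t) (y + 3 * t)) 0 := by
  simp only [gammaDet, Matrix.det_apply, Matrix.of_apply, gammaEntry]
  refine tendsto_finsetSum _ fun σ _ => ContinuousAt.const_smul
    (tendsto_finsetProd _ fun i _ => ?_) _
  refine ContinuousAt.mul (ContinuousAt.mul (continuousAt_Gamma_comp (by fun_prop) ?_)
    (continuous_inv_Gamma_comp (by fun_prop)).continuousAt)
    (continuous_inv_Gamma_comp (by fun_prop)).continuousAt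
  simp
  positivity

theorem continuousAt_prod_gammaFactor (n x y : ℕ) :
    ContinuousAt (fun t : ℂ => ∏ j ∈ range n, gammaFactor n (x + t) (y + 3 * t) j) 0 := by
  simp only [gammaFactor]
  refine tendsto_finsetProd _ fun j _ => ?_
  refine ContinuousAt.mul (ContinuousAt.mul (ContinuousAt.mul (ContinuousAt.mul
    (continuousAt_const.mul (continuousAt_Gamma_comp (by fun_prop) ?_))
    ((Polynomial.continuous _).comp (by fun_prop)).continuousAt)
    ((Polynomial.continuous _).comp (by fun_prop)).continuousAt)
    (continuous_inv_Gamma_comp (by fun_prop)).continuousAt)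
    (continuous_inv_Gamma_comp (by fun_prop)).continuousAt
  simp
  positivity

theorem isGenericPair_of_norm_lt {t : ℂ} (h₀ : t ≠ 0) (h₁ : ‖t‖ < 1 / 7) (x y : ℕ) :
    IsGenericPair (x + t) (y + 3 * t) := by
  have H (c : ℝ) (hc : c ≠ 0) (hc' : |c| ≤ 7) (k : ℤ) : (k : ℂ) + c * t ≠ 0 := by
    intro h
    have hn : ‖(k : ℂ)‖ = |c| * ‖t‖ := by
      rw [eq_neg_of_add_eq_zero_left h, norm_neg, norm_mul, norm_real, Real.norm_eq_abs]
    rw [norm_intCast] at hn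
    have hk : |(k : ℝ)| < 1 := by nlinarith [norm_nonneg t]
    have hk' : k = 0 := Int.abs_lt_one_iff.1 (by exact_mod_cast hk)
    subst hk'
    simp [h₀, hc] at h
  intro k
  refine ⟨?_, ?_, ?_, ?_, ?_⟩
  · convert H 1 (by norm_num) (by norm_num) (x + k) using 1
    push_cast; ring
  · convert H 3 (by norm_num) (by norm_num [abs_of_pos]) (y + k) using 1
    push_cast; ring
  · convert H 4 (by norm_num) (by norm_num [abs_of_pos]) (x + y + k) using 1
    push_cast; ring
  · convert H (-2) (by norm_num) (by norm_num [abs_of_pos]) (x - y + k) using 1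
    push_cast; ring
  · convert H 7 (by norm_num) (by norm_num [abs_of_pos]) (x + 2 * y + k) using 1
    push_cast; ring

theorem gammaDet_natCast (n x y : ℕ) :
    gammaDet n x y = ∏ j ∈ range n, gammaFactor n x y j := by
  have hev : ∀ᶠ t : ℂ in nhdsWithin 0 {0}ᶜ, gammaDet n (x + t) (y + 3 * t) =
      ∏ j ∈ range n, gammaFactor n (x + t) (y + 3 * t) j := by
    filter_upwards [self_mem_nhdsWithin,
      mem_nhdsWithin_of_mem_nhds (Metric.ball_mem_nhds (0 : ℂ) (by norm_num : (0 : ℝ) < 1 / 7))]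
      with t ht ht'
    exact gammaDet_eq_of_isGenericPair n (isGenericPair_of_norm_lt ht (by simpa using ht') x y)
  have h := tendsto_nhds_unique_of_eventuallyEq
    ((continuousAt_gammaDet n x y).tendsto.mono_left nhdsWithin_le_nhds)
    ((continuousAt_prod_gammaFactor n x y).tendsto.mono_left nhdsWithin_le_nhds) hev
  simpa using h

theorem cast_binomIntQ (m : ℕ) (r : ℤ) :
    (binomIntQ m r : ℂ) = Gamma (m + 1) * (Gamma (r + 1))⁻¹ * (Gamma (m - r + 1))⁻¹ := by
  unfold binomIntQ
  rcases lt_or_ge r 0 with h | h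
  · obtain ⟨k, rfl⟩ : ∃ k : ℕ, r = -k - 1 := ⟨(-r - 1).toNat, by lia⟩
    rw [if_neg (by lia)]
    simp [Gamma_neg_nat_eq_zero]
  lift r to ℕ using h
  simp only [Int.natCast_nonneg, if_true, Int.toNat_natCast, Rat.cast_natCast, Int.cast_natCast]
  rcases lt_or_ge m r with h | h
  · obtain ⟨k, rfl⟩ := Nat.exists_eq_add_of_lt h
    rw [Nat.choose_eq_zero_of_lt h,
      show (m : ℂ) - ((m + k + 1 : ℕ) : ℂ) + 1 = -k by push_cast; ring, Gamma_neg_nat_eq_zero]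
    simp
  · obtain ⟨k, rfl⟩ := Nat.exists_eq_add_of_le h
    rw [show ((r + k : ℕ) : ℂ) - r + 1 = k + 1 by push_cast; ring, Gamma_nat_eq_factorial,
      Gamma_nat_eq_factorial, Gamma_nat_eq_factorial, Nat.cast_add_choose]
    field_simp

theorem inv_Gamma_eq (s : ℂ) : (Gamma s)⁻¹ = s * (s + 1) * (Gamma (s + 2))⁻¹ := by
  rw [one_div_Gamma_eq_self_mul_one_div_Gamma_add_one s,
    one_div_Gamma_eq_self_mul_one_div_Gamma_add_one (s + 1)]
  ring_nf

theorem cast_binomDiff_one (x y i j : ℕ) :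
    (binomDiff (x + y + (j + 1) + 2 * i) ((x + 2 * (j + 1) : ℕ) + i) 1 : ℂ) =
      (x - y + 3 * j + 3) * gammaEntry x y i j := by
  simp only [binomDiff, gammaEntry]
  push_cast
  rw [cast_binomIntQ, cast_binomIntQ]
  push_cast
  have hM : (x : ℂ) + y + j + 2 * i + 2 ≠ 0 := by
    have : ((x + y + j + 2 * i + 2 : ℕ) : ℂ) ≠ 0 := Nat.cast_ne_zero.2 (by lia)
    exact_mod_cast this
  have hG := Gamma_add_one _ hM
  have h₁ := inv_Gamma_eq (x + 2 * j + i + 2)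
  have h₂ := inv_Gamma_eq (y - j + i - 1)
  rw [show (x : ℂ) + 2 * j + i + 2 + 2 = x + 2 * j + i + 4 by ring] at h₁
  rw [show (y : ℂ) - j + i - 1 + 2 = y - j + i + 1 by ring] at h₂
  rw [show (x : ℂ) + y + j + 2 * i + 2 + 1 = x + y + j + 2 * i + 3 by ring] at hG
  rw [show (x : ℂ) + y + (j + 1) + 2 * i + 1 = x + y + j + 2 * i + 2 by ring,
    show (x : ℂ) + 2 * (j + 1) + i - 1 + 1 = x + 2 * j + i + 2 by ring,
    show (x : ℂ) + y + (j + 1) + 2 * i - (x + 2 * (j + 1) + i - 1) + 1 = y - j + i + 1 by ring,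
    show (x : ℂ) + 2 * (j + 1) + i + 1 + 1 = x + 2 * j + i + 4 by ring,
    show (x : ℂ) + y + (j + 1) + 2 * i - (x + 2 * (j + 1) + i + 1) + 1 = y - j + i - 1 by ring,
    h₁, h₂, hG]
  ring

theorem gammaFactor_natCast {n x y j : ℕ} (h : j < n) :
    (x - y + 3 * j + 3) * gammaFactor n x y j =
      (((j.factorial : ℚ) * ((x + y + 2 * (j + 1)).factorial : ℚ) *
        (ascPochhammer ℚ (j + 1)).eval ((x : ℚ) - (y : ℚ) + 2 * (j + 1 : ℕ) + 1) *
        (ascPochhammer ℚ (n - (j + 1))).eval ((x + 2 * y + 3 * (j + 1) + 1 : ℕ) : ℚ)) /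
          (((x + n + 2 * (j + 1)).factorial : ℚ) * ((y + n - (j + 1)).factorial : ℚ)) : ℚ) := by
  have hP (k : ℕ) (q : ℚ) : (((ascPochhammer ℚ k).eval q : ℚ) : ℂ) =
      (ascPochhammer ℂ k).eval (q : ℂ) := by
    rw [← ascPochhammer_map (Rat.castHom ℂ) k]
    exact (Polynomial.eval_map_apply (f := Rat.castHom ℂ) (p := ascPochhammer ℚ k) q).symm
  obtain ⟨m, rfl⟩ := Nat.exists_eq_add_of_lt h
  rw [show y + (j + m + 1) - (j + 1) = y + m by lia, show j + m + 1 - (j + 1) = m by lia]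
  simp only [gammaFactor, show j + m + 1 - 1 - j = m by lia]
  push_cast [hP]
  simp only [← Gamma_nat_eq_factorial, ascPochhammer_succ_eval]
  push_cast
  ring_nf

/-- Determinant evaluation for rhombus tilings of a pentagonal region:
`det_{1≤i,j≤n}(C(x+y+j, x−i+2j) − C(x+y+j, x+i+2j))
 = ∏_{j=1}^n (j−1)!(x+y+2j)!(x−y+2j+1)_j(x+2y+3j+1)_{n−j}/((x+n+2j)!(y+n−j)!)`.
Rows/columns are indexed by `Fin n` (0-based), so the 1-based indices are
`(i : ℕ) + 1` and `(j : ℕ) + 1`; `(a)_k` is the ascending Pochhammer symbol. -/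
theorem stmt_17 (n : ℕ) (hn : 0 < n) (x y : ℕ) :
    Matrix.det (Matrix.of fun i j : Fin n =>
        binomIntQ (x + y + ((j : ℕ) + 1))
            ((x : ℤ) - (((i : ℕ) + 1 : ℕ) : ℤ) + 2 * (((j : ℕ) + 1 : ℕ) : ℤ)) -
          binomIntQ (x + y + ((j : ℕ) + 1))
            ((x : ℤ) + (((i : ℕ) + 1 : ℕ) : ℤ) + 2 * (((j : ℕ) + 1 : ℕ) : ℤ))) =
      ∏ j ∈ Icc 1 n,
        (((j - 1).factorial : ℚ) * ((x + y + 2 * j).factorial : ℚ) *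
            (ascPochhammer ℚ j).eval ((x : ℚ) - (y : ℚ) + 2 * (j : ℚ) + 1) *
            (ascPochhammer ℚ (n - j)).eval ((x + 2 * y + 3 * j + 1 : ℕ) : ℚ)) /
          (((x + n + 2 * j).factorial : ℚ) * ((y + n - j).factorial : ℚ)) := by
  refine Rat.cast_injective (α := ℂ) ?_
  have hM : (Matrix.of fun i j : Fin n =>
      binomIntQ (x + y + ((j : ℕ) + 1))
          ((x : ℤ) - (((i : ℕ) + 1 : ℕ) : ℤ) + 2 * (((j : ℕ) + 1 : ℕ) : ℤ)) -
        binomIntQ (x + y + ((j : ℕ) + 1))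
          ((x : ℤ) + (((i : ℕ) + 1 : ℕ) : ℤ) + 2 * (((j : ℕ) + 1 : ℕ) : ℤ))) =
      Matrix.of fun i j : Fin n => binomDiff (x + y + ((j : ℕ) + 1))
        ((x + 2 * ((j : ℕ) + 1) : ℕ) : ℤ) ((i : ℕ) + 1) := by
    ext i j
    simp only [Matrix.of_apply, binomDiff]
    push_cast
    ring_nf
  rw [hM, det_binomDiff n (fun j => x + y + (j + 1)) fun j => ((x + 2 * (j + 1) : ℕ) : ℤ),
    ← Rat.coe_castHom, RingHom.map_det]
  have hN : (Rat.castHom ℂ).mapMatrix (Matrix.of fun i j : Fin n =>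
      binomDiff (x + y + ((j : ℕ) + 1) + 2 * i) (((x + 2 * ((j : ℕ) + 1) : ℕ) : ℤ) + (i : ℕ)) 1) =
      Matrix.of fun i j : Fin n => ((x : ℂ) - y + 3 * (j : ℕ) + 3) *
        (Matrix.of fun i j : Fin n => gammaEntry x y i j) i j := by
    ext i j
    exact cast_binomDiff_one x y i j
  rw [hN, Matrix.det_mul_row, ← gammaDet, gammaDet_natCast,
    Fin.prod_univ_eq_prod_range (fun j : ℕ => (x : ℂ) - y + 3 * j + 3), ← prod_mul_distrib,
    ← Finset.Ico_add_one_right_eq_Icc, prod_Ico_eq_prod_range, map_prod, Nat.add_sub_cancel]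
  refine prod_congr rfl fun j hj => ?_
  rw [gammaFactor_natCast (mem_range.1 hj), add_comm 1 j]
  rfl
end

section
/- Let n be a positive integer and q an element of a commutative ring R (for instance q real). For permutations σ, π of {1,...,n}, let inv(σ) denote the number of inversions of σ, i.e. the number of pairs (i, j) with 1 ≤ i < j ≤ n and σ(i) > σ(j). Then the determinant of the n!×n! matrix whose rows and columns are indexed by the symmetric group S_n and whose (σ, π)-entry is q^{inv(σ∘π^{−1})} equals ∏_{i=2}^{n} (1 − q^{i(i−1)})^{C(n,i)·(i−2)!·(n−i+1)!}, where C(n,i) is the ordinary binomial coefficient. (Theorem of Varchenko and Zagier.) -/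
open Finset

/-- The number of inversions of a permutation `σ` of `Fin n`: the number of pairs
`(i, j)` with `i < j` and `σ i > σ j`. -/
def permInv {n : ℕ} (σ : Equiv.Perm (Fin n)) : ℕ :=
  (Finset.univ.filter fun p : Fin n × Fin n => p.1 < p.2 ∧ σ p.2 < σ p.1).card

section RegularRepresentation

variable {R : Type*} [CommRing R] {G H : Type*} [Group G] [Group H]
  [Fintype G] [Fintype H] [DecidableEq G] [DecidableEq H]

/-- The matrix of left multiplication by a group element, as a monoid homomorphism. -/
def leftMulMatrixHom (R G : Type*) [CommRing R] [Group G] [Fintype G] [DecidableEq G] :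
    G →* Matrix G G R where
  toFun g := Matrix.of fun σ π => if σ = g * π then 1 else 0
  map_one' := by ext; simp [Matrix.one_apply]
  map_mul' g h := by ext; simp [Matrix.mul_apply, mul_assoc]

theorem leftMulMatrixHom_apply (g σ π : G) :
    leftMulMatrixHom R G g σ π = if σ = g * π then 1 else 0 := rfl

theorem sum_smul_leftMulMatrixHom (a : G → R) :
    ∑ g, a g • leftMulMatrixHom R G g = Matrix.of fun σ π => a (σ * π⁻¹) := by
  ext σ π
  simp [Matrix.sum_apply, leftMulMatrixHom_apply, ← mul_inv_eq_iff_eq_mul]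

/-- The regular representation of `G`, restricted to `H`, is a multiple of the regular
representation of `H`. -/
theorem det_sum_smul_leftMulMatrixHom_map (f : H →* G) (hf : Function.Injective f) (k : ℕ)
    (hk : Fintype.card G = k * Fintype.card H) (a : H → R) :
    (∑ h, a h • leftMulMatrixHom R G (f h)).det =
      (∑ h, a h • leftMulMatrixHom R H h).det ^ k := by
  classical
  have hinj : Function.Injective
      fun x : H × (G ⧸ f.range) => f x.1 * (Quotient.out x.2)⁻¹ := by
    rintro ⟨h, c⟩ ⟨h', d⟩ hx
    have hx' : f h * c.out⁻¹ = f h' * d.out⁻¹ := hx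
    have hcd : c = d := by
      rw [← c.out_eq', ← d.out_eq']
      refine QuotientGroup.eq.2 ⟨h⁻¹ * h', ?_⟩
      rw [map_mul, map_inv, inv_mul_eq_iff_eq_mul, ← mul_assoc, hx', inv_mul_cancel_right]
    subst hcd
    simpa using hf (mul_right_cancel hx')
  have hq : Fintype.card (G ⧸ f.range) = k := by
    have h1 := Subgroup.card_eq_card_quotient_mul_card_subgroup f.range
    have h2 : Nat.card f.range = Nat.card H :=
      (Nat.card_congr (f.ofInjective hf).toEquiv).symm
    rw [h2, Nat.card_eq_fintype_card, Nat.card_eq_fintype_card, Nat.card_eq_fintype_card,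
      hk] at h1
    exact (Nat.eq_of_mul_eq_mul_right Fintype.card_pos h1).symm
  let E : H × (G ⧸ f.range) ≃ G := Equiv.ofBijective _
    ((Fintype.bijective_iff_injective_and_card _).2 ⟨hinj, by
      rw [Fintype.card_prod, hq, hk, mul_comm]⟩)
  have hE (h : H) (c : G ⧸ f.range) : E (h, c) = f h * c.out⁻¹ := rfl
  rw [← Matrix.det_submatrix_equiv_self E]
  have hblock : (∑ h, a h • leftMulMatrixHom R G (f h)).submatrix E E =
      Matrix.blockDiagonal fun _ : G ⧸ f.range => ∑ h, a h • leftMulMatrixHom R H h := by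
    ext ⟨h, c⟩ ⟨h', d⟩
    have key (x : H) : E (h, c) = f x * E (h', d) ↔ h = x * h' ∧ c = d := by
      rw [← Prod.mk.injEq, ← E.injective.eq_iff, hE (x * h'), hE h', map_mul, mul_assoc]
    simp only [Matrix.submatrix_apply, Matrix.sum_apply, Matrix.smul_apply,
      leftMulMatrixHom_apply, key, Matrix.blockDiagonal_apply]
    by_cases hcd : c = d <;> simp [hcd]
  rw [hblock, Matrix.det_blockDiagonal, Finset.prod_const, Finset.card_univ, hq]

theorem det_one_sub_cyclic_shift (d : ℕ) (t : R) :
    (Matrix.of fun i j : Fin (d + 1) =>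
      (if i = j then 1 else 0) - t * (if i = j + 1 then 1 else 0)).det = 1 - t ^ (d + 1) := by
  rcases d with _ | d
  · simp
  · rw [Matrix.det_succ_row_zero, Fin.sum_univ_succ, Fin.sum_univ_castSucc]
    have hval (j : Fin (d + 2)) (i : Fin (d + 1)) : i.succ = j + 1 ↔ (i : ℕ) = j := by
      rw [← Fin.val_inj, Fin.val_add_one, Fin.val_succ]
      split_ifs with h
      · have hj : (j : ℕ) = d + 1 := by rw [h]; rfl
        rw [false_iff]
        omega
      · omega
    rw [Finset.sum_eq_zero, zero_add, Matrix.det_of_isLowerTriangular,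
      Matrix.det_of_isUpperTriangular]
    · simp only [Matrix.submatrix_apply, Matrix.of_apply, hval, Fin.succAbove_zero, Fin.succ_last,
        Fin.succAbove_last]
      have hsign : (-1 : R) ^ (d + 1) * (-t) ^ (d + 1) = t ^ (d + 1) := by
        rw [← mul_pow, neg_one_mul, neg_neg]
      simp [Fin.ext_iff]
      linear_combination (-t) * hsign
    · intro i j hij
      have hij' : (j : ℕ) < i := hij
      simp only [Matrix.submatrix_apply, Matrix.of_apply, hval, Fin.succ_last,
        Fin.succAbove_last]
      rw [if_neg (by simp [Fin.ext_iff]; omega), if_neg (by simp; omega), mul_zero, sub_zero]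
    · intro i j hij
      have hij' : (i : ℕ) < j := hij
      simp only [Matrix.submatrix_apply, Matrix.of_apply, hval, Fin.succAbove_zero]
      rw [if_neg (by simp [Fin.ext_iff]; omega), if_neg (by simp; omega), mul_zero, sub_zero]
    · intro i _
      have h0 : (0 : Fin (d + 2)) ≠ i.castSucc.succ := (Fin.succ_ne_zero _).symm
      have h1 : (0 : Fin (d + 2)) ≠ i.castSucc.succ + 1 := by
        rw [Ne, ← Fin.val_inj, Fin.val_add_one]
        have := i.isLt
        rw [if_neg (by rw [← Fin.val_inj, Fin.val_last]; simp; omega)]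
        simp
      simp [h0, h1]

theorem det_one_sub_smul_leftMulMatrixHom (g : G) (t : R) :
    (1 - t • leftMulMatrixHom R G g).det =
      (1 - t ^ orderOf g) ^ (Fintype.card G / orderOf g) := by
  classical
  let g' : Subgroup.zpowers g := ⟨g, Subgroup.mem_zpowers g⟩
  have hcard : Fintype.card (Subgroup.zpowers g) = orderOf g := Fintype.card_zpowers
  have h := det_sum_smul_leftMulMatrixHom_map (R := R) (Subgroup.zpowers g).subtype
    (Subgroup.subtype_injective _) (Fintype.card G / orderOf g)
    (by rw [hcard, Nat.div_mul_cancel (orderOf_dvd_card)])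
    (fun h => (if h = 1 then 1 else 0) - (if h = g' then t else 0))
  simp only [sub_smul, Finset.sum_sub_distrib, ite_smul, one_smul, zero_smul,
    Finset.sum_ite_eq', Finset.mem_univ, if_true, map_one, Subgroup.subtype_apply] at h
  have h1 : ((1 : Subgroup.zpowers g) : G) = 1 := rfl
  rw [h1, map_one] at h
  rw [show g = g' from rfl, h]
  congr 1
  change _ = 1 - t ^ orderOf g
  obtain ⟨d, hd⟩ := Nat.exists_eq_add_one_of_ne_zero (orderOf_pos g).ne'
  let e : Fin (d + 1) ≃ Subgroup.zpowers g :=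
    (finCongr hd.symm).trans (finEquivZPowers (isOfFinOrder_of_finite g))
  rw [hd, ← det_one_sub_cyclic_shift, ← Matrix.det_submatrix_equiv_self e]
  congr 1
  ext i j
  have he (i) : e i = g' ^ (i : ℕ) := by
    ext
    simp [e, g', finEquivZPowers_apply]
  have key : e i = g' * e j ↔ i = j + 1 := by
    have : g' * e j = e (j + 1) := by
      rw [he, he, ← pow_succ', pow_eq_pow_iff_modEq, Fin.val_add]
      have hg' : orderOf g' = d + 1 := by rw [← hd, ← Subgroup.orderOf_coe]
      rw [hg', Nat.ModEq, Nat.mod_mod, Fin.val_one', Nat.add_mod_mod]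
    rw [this, e.injective.eq_iff]
  simp [leftMulMatrixHom_apply, key, Matrix.one_apply]

end RegularRepresentation

section Permutations

/-- The embedding of permutation groups that extends a permutation of
`{1, ..., n}` by fixing `0`. -/
def permFixZero (n : ℕ) : Equiv.Perm (Fin n) →* Equiv.Perm (Fin (n + 1)) where
  toFun e := Equiv.Perm.decomposeFin.symm (0, e)
  map_one' := by simp; rfl
  map_mul' e e' := by
    ext i
    refine Fin.cases ?_ (fun i => ?_) i <;> simp

@[simp]
theorem permFixZero_zero {n : ℕ} (e : Equiv.Perm (Fin n)) : permFixZero n e 0 = 0 := by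
  simp [permFixZero]

@[simp]
theorem permFixZero_succ {n : ℕ} (e : Equiv.Perm (Fin n)) (i : Fin n) :
    permFixZero n e i.succ = (e i).succ := by
  simp [permFixZero]

theorem permFixZero_injective (n : ℕ) : Function.Injective (permFixZero n) := by
  intro e e' h
  ext i
  have := congrArg (fun σ => σ i.succ) h
  simpa [Fin.ext_iff] using this

/-- Every permutation of `{0, ..., n}` is uniquely a permutation fixing `0` times one of the
cycles `(0 1 ... i)`. -/
noncomputable def permFixZeroMulCycleRange (n : ℕ) :
    Equiv.Perm (Fin n) × Fin (n + 1) ≃ Equiv.Perm (Fin (n + 1)) :=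
  Equiv.ofBijective (fun x => permFixZero n x.1 * x.2.cycleRange) <|
    (Fintype.bijective_iff_injective_and_card _).2 ⟨by
      rintro ⟨e, i⟩ ⟨e', j⟩ h
      have h' : permFixZero n e * i.cycleRange = permFixZero n e' * j.cycleRange := h
      have hij : i = j := by
        have := congrArg (fun σ => σ i) h'
        simp only [Equiv.Perm.mul_apply, Fin.cycleRange_self, permFixZero_zero] at this
        have h2 := (permFixZero n e').injective (this.symm.trans (permFixZero_zero e').symm)
        rw [← Fin.cycleRange_self j] at h2
        exact j.cycleRange.injective h2
      subst hij
      simpa using permFixZero_injective n (mul_right_cancel h'), by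
      simp [Fintype.card_perm, Nat.factorial_succ, mul_comm]⟩

theorem permFixZeroMulCycleRange_apply {n : ℕ} (e : Equiv.Perm (Fin n)) (i : Fin (n + 1)) :
    permFixZeroMulCycleRange n (e, i) = permFixZero n e * i.cycleRange := rfl

theorem permInv_eq_sum {n : ℕ} (σ : Equiv.Perm (Fin n)) :
    permInv σ = ∑ i, ∑ j, if i < j ∧ σ j < σ i then 1 else 0 := by
  rw [permInv, Finset.card_filter, Fintype.sum_prod_type]

theorem permInv_permFixZero_mul_cycleRange {n : ℕ} (e : Equiv.Perm (Fin n)) (i : Fin (n + 1)) :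
    permInv (permFixZero n e * i.cycleRange) = permInv e + i := by
  have hlt : (∑ j : Fin n, if i.succAbove j < i then 1 else 0) = (i : ℕ) := by
    have h := Fin.sum_univ_succAbove (fun j : Fin (n + 1) => if j < i then 1 else 0) i
    rw [if_neg (lt_irrefl i), zero_add] at h
    rw [← h, ← Finset.card_filter, Finset.filter_gt_eq_Iio, Fin.card_Iio]
  rw [permInv_eq_sum, permInv_eq_sum, Fin.sum_univ_succAbove _ i]
  simp_rw [Fin.sum_univ_succAbove _ i]
  simp [Finset.sum_add_distrib, hlt, add_comm]

theorem coe_cycleRange {n : ℕ} (i j : Fin n) :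
    (i.cycleRange j : ℕ) = if (j : ℕ) < i then (j : ℕ) + 1 else if (j : ℕ) = i then 0 else j := by
  rcases lt_or_ge i j with h | h
  · rw [Fin.cycleRange_of_gt h]
    rw [Fin.lt_def] at h
    split_ifs <;> omega
  · simp only [Fin.coe_cycleRange_of_le h, Fin.ext_iff]
    rw [Fin.le_def] at h
    split_ifs <;> omega

theorem coe_permFixZero_cycleRange {n : ℕ} (m : Fin n) (x : Fin (n + 1)) :
    (permFixZero n m.cycleRange x : ℕ) = if (x : ℕ) = 0 then 0 else
      if (x : ℕ) < m + 1 then (x : ℕ) + 1 else if (x : ℕ) = m + 1 then 1 else x := by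
  refine Fin.cases (by simp) (fun x => ?_) x
  rw [permFixZero_succ, Fin.val_succ, coe_cycleRange]
  simp only [Fin.val_succ]
  split_ifs <;> omega

theorem cycleRange_succ_mul_cycleRange_succ {n : ℕ} {i m : Fin n} (him : i ≤ m) :
    i.succ.cycleRange * m.succ.cycleRange =
      permFixZero n m.cycleRange * i.castSucc.cycleRange := by
  ext x
  rw [Fin.le_def] at him
  simp only [Equiv.Perm.mul_apply, coe_cycleRange, coe_permFixZero_cycleRange, Fin.val_succ,
    Fin.val_castSucc]
  have := x.isLt
  split_ifs <;> omega

theorem orderOf_cycleRange {n : ℕ} (i : Fin n) : orderOf i.cycleRange = i + 1 := by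
  obtain ⟨n, rfl⟩ := Nat.exists_eq_add_one_of_ne_zero i.pos.ne'
  by_cases h : i = 0
  · simp [h]
  · rw [← Equiv.Perm.lcm_cycleType, Fin.cycleType_cycleRange h]
    simp

end Permutations

section CycleSums

variable {R : Type*} [CommRing R]

/-- The partial sums of `∑ i, q ^ i (0 1 ... i)` in the regular representation of the
permutations of `{0, ..., n}`. -/
def cycleSum (n : ℕ) (q : R) (m : ℕ) :
    Matrix (Equiv.Perm (Fin (n + 1))) (Equiv.Perm (Fin (n + 1))) R :=
  ∑ k ∈ range (m + 1),
    q ^ k • leftMulMatrixHom R _ (Fin.cycleRange (Fin.ofNat (n + 1) k))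

theorem cycleSum_succ_mul {n m : ℕ} (hm : m < n) (q : R) :
    cycleSum n q (m + 1) *
        (1 - q ^ (m + 1) • leftMulMatrixHom R _ (Fin.succ ⟨m, hm⟩).cycleRange) =
      (1 - q ^ (m + 2) • leftMulMatrixHom R _ (permFixZero n (Fin.cycleRange ⟨m, hm⟩))) *
        cycleSum n q m := by
  have hcycle (k : ℕ) (hk : k ∈ range (m + 1)) :
      Fin.cycleRange (Fin.ofNat (n + 1) (k + 1)) * (Fin.succ ⟨m, hm⟩).cycleRange =
        permFixZero n (Fin.cycleRange ⟨m, hm⟩) * Fin.cycleRange (Fin.ofNat (n + 1) k) := by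
    rw [mem_range] at hk
    have h1 : Fin.ofNat (n + 1) (k + 1) = Fin.succ ⟨k, by omega⟩ := by
      ext; simp; omega
    have h2 : Fin.ofNat (n + 1) k = Fin.castSucc ⟨k, by omega⟩ := by
      ext; simp; omega
    rw [h1, h2, cycleRange_succ_mul_cycleRange_succ]
    rw [Fin.le_def]
    simp; omega
  have hlast : Fin.ofNat (n + 1) (m + 1) = Fin.succ ⟨m, hm⟩ := by
    ext; simp; omega
  have hfirst : cycleSum n q (m + 1) = 1 + ∑ k ∈ range (m + 1),
      q ^ (k + 1) • leftMulMatrixHom R _ (Fin.cycleRange (Fin.ofNat (n + 1) (k + 1))) := by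
    rw [cycleSum, sum_range_succ', add_comm (Finset.sum _ _)]
    simp
  have hsum : (∑ k ∈ range (m + 1),
      q ^ (k + 1) • leftMulMatrixHom R _ (Fin.cycleRange (Fin.ofNat (n + 1) (k + 1)))) *
        q ^ (m + 1) • leftMulMatrixHom R _ (Fin.succ ⟨m, hm⟩).cycleRange =
      q ^ (m + 2) • leftMulMatrixHom R _ (permFixZero n (Fin.cycleRange ⟨m, hm⟩)) *
        cycleSum n q m := by
    rw [cycleSum, sum_mul, mul_sum]
    refine sum_congr rfl fun k hk => ?_
    rw [smul_mul_smul_comm, smul_mul_smul_comm, ← map_mul, ← map_mul, hcycle k hk]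
    congr 1
    ring
  rw [mul_sub, mul_one, sub_mul, one_mul, ← hsum]
  nth_rw 2 [hfirst]
  rw [cycleSum, sum_range_succ, ← cycleSum, hlast, add_mul, one_mul]
  abel

theorem factorial_div_eq_add {N m : ℕ} (hm : 0 < m) (hN : m + 1 ≤ N) :
    N.factorial / m = N.factorial / ((m + 1) * m) + N.factorial / (m + 1) := by
  have hdvd : (m + 1) * m ∣ N.factorial :=
    (mul_dvd_mul_left _ (Nat.dvd_factorial hm le_rfl)).trans
      (Nat.factorial_dvd_factorial hN : (m + 1) * m.factorial ∣ _)
  obtain ⟨c, hc⟩ := hdvd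
  rw [hc, Nat.mul_div_cancel_left _ (by positivity), mul_assoc,
    Nat.mul_div_cancel_left _ (by positivity), mul_left_comm, Nat.mul_div_cancel_left _ hm]
  ring

theorem det_cycleSum {n m : ℕ} [IsDomain R] {q : R} (hq : ∀ k, 0 < k → q ^ k ≠ 1)
    (hm : m ≤ n) :
    (cycleSum n q m).det =
      ∏ i ∈ Icc 2 (m + 1), (1 - q ^ (i * (i - 1))) ^ ((n + 1).factorial / (i * (i - 1))) := by
  induction m with
  | zero => simp [cycleSum]
  | succ m ih =>
    have h := congrArg Matrix.det (cycleSum_succ_mul hm q)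
    rw [Matrix.det_mul, Matrix.det_mul, det_one_sub_smul_leftMulMatrixHom,
      det_one_sub_smul_leftMulMatrixHom, orderOf_injective _ (permFixZero_injective n),
      orderOf_cycleRange, orderOf_cycleRange, ih (by omega), Fintype.card_perm, Fintype.card_fin,
      ← pow_mul, ← pow_mul, Fin.val_succ, mul_comm (m + 1) (m + 1 + 1),
      factorial_div_eq_add (Nat.succ_pos m) (by omega), pow_add, mul_right_comm] at h
    rw [prod_Icc_succ_top (by omega), mul_comm]
    exact mul_right_cancel₀
      (pow_ne_zero _ (sub_ne_zero.2 (hq _ (by positivity)).symm)) h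

theorem sum_pow_permInv_smul (n : ℕ) (q : R) :
    ∑ σ, q ^ permInv σ • leftMulMatrixHom R (Equiv.Perm (Fin (n + 1))) σ =
      (∑ e, q ^ permInv e • leftMulMatrixHom R _ (permFixZero n e)) * cycleSum n q n := by
  rw [← (permFixZeroMulCycleRange n).sum_comp, Fintype.sum_prod_type, cycleSum,
    sum_range, sum_mul_sum]
  refine sum_congr rfl fun e _ => sum_congr rfl fun i _ => ?_
  have hi : Fin.ofNat (n + 1) i = i := by ext; simp
  rw [permFixZeroMulCycleRange_apply, permInv_permFixZero_mul_cycleRange, map_mul, pow_add, hi,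
    smul_mul_smul_comm]

theorem choose_mul_factorial_mul_factorial_succ {n i : ℕ} (hi : 2 ≤ i) (hin : i ≤ n + 1) :
    (n + 1).choose i * (i - 2).factorial * (n + 1 - i + 1).factorial =
      n.choose i * (i - 2).factorial * (n - i + 1).factorial * (n + 1) +
        (n + 1).factorial / (i * (i - 1)) := by
  obtain ⟨i, rfl⟩ := Nat.exists_eq_add_of_le' hi
  have h1 : (n + 1).factorial / ((i + 2) * (i + 2 - 1)) =
      (n + 1).choose (i + 2) * i.factorial * (n + 1 - (i + 2)).factorial := by
    refine Nat.div_eq_of_eq_mul_right (Nat.mul_pos (by omega) (by omega)) ?_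
    rw [← Nat.choose_mul_factorial_mul_factorial hin]
    simp only [Nat.factorial_succ, Nat.add_succ_sub_one]
    ring
  have h2 : n.choose (i + 2) * (n + 1) = (n + 1).choose (i + 2) * (n + 1 - (i + 2)) := by
    exact Nat.choose_mul_succ_eq n (i + 2)
  rw [h1]
  rcases Nat.lt_or_ge n (i + 2) with h | h
  · rw [Nat.choose_eq_zero_of_lt h]
    have : n + 1 - (i + 2) = 0 := by omega
    simp [this]
  · obtain ⟨k, rfl⟩ := Nat.exists_eq_add_of_le' h
    have e1 : k + (i + 2) + 1 - (i + 2) = k + 1 := by omega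
    have e2 : k + (i + 2) - (i + 2) = k := by omega
    simp only [e1, e2, Nat.add_sub_cancel, Nat.factorial_succ] at h2 ⊢
    linear_combination (i.factorial * ((k + 1) * k.factorial)) * h2.symm

theorem det_pow_permInv_of_isDomain [IsDomain R] {q : R} (hq : ∀ k, 0 < k → q ^ k ≠ 1) (n : ℕ) :
    (Matrix.of fun σ π : Equiv.Perm (Fin n) => q ^ permInv (σ * π⁻¹)).det =
      ∏ i ∈ Icc 2 n,
        (1 - q ^ (i * (i - 1))) ^ (n.choose i * (i - 2).factorial *
          (n - i + 1).factorial) := by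
  induction n with
  | zero => simp [permInv]
  | succ n ih =>
    have hcard : Fintype.card (Equiv.Perm (Fin (n + 1))) =
        (n + 1) * Fintype.card (Equiv.Perm (Fin n)) := by
      simp [Fintype.card_perm, Nat.factorial_succ]
    rw [← sum_smul_leftMulMatrixHom fun σ => q ^ permInv σ] at ih ⊢
    rw [sum_pow_permInv_smul, Matrix.det_mul,
      det_sum_smul_leftMulMatrixHom_map _ (permFixZero_injective n) _ hcard
        (fun e => q ^ permInv e), ih, det_cycleSum hq le_rfl, ← prod_pow]
    have hext : ∏ i ∈ Icc 2 n, ((1 - q ^ (i * (i - 1))) ^ (n.choose i * (i - 2).factorial *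
          (n - i + 1).factorial)) ^ (n + 1) =
        ∏ i ∈ Icc 2 (n + 1), ((1 - q ^ (i * (i - 1))) ^ (n.choose i * (i - 2).factorial *
          (n - i + 1).factorial)) ^ (n + 1) := by
      refine prod_subset (Icc_subset_Icc_right (Nat.le_succ n)) fun i hi hi' => ?_
      rw [mem_Icc] at hi hi'
      simp [Nat.choose_eq_zero_of_lt (show n < i by omega)]
    rw [hext, ← prod_mul_distrib]
    refine prod_congr rfl fun i hi => ?_
    rw [mem_Icc] at hi
    rw [← pow_mul, ← pow_add, choose_mul_factorial_mul_factorial_succ hi.1 hi.2]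

end CycleSums


/-- The Varchenko–Zagier determinant evaluation: the determinant of the `n! × n!`
matrix with rows and columns indexed by the symmetric group on `n` letters and
`(σ, π)`-entry `q^{inv(σπ⁻¹)}` equals
`∏_{i=2}^n (1 − q^{i(i−1)})^{C(n,i)(i−2)!(n−i+1)!}`. -/
theorem stmt_19 (n : ℕ) (hn : 0 < n) (R : Type*) [CommRing R] (q : R) :
    Matrix.det (Matrix.of fun σ π : Equiv.Perm (Fin n) => q ^ permInv (σ * π⁻¹)) =
      ∏ i ∈ Icc 2 n,
        (1 - q ^ (i * (i - 1))) ^ (n.choose i * (i - 2).factorial *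
          (n - i + 1).factorial) := by
  have hX (k : ℕ) (hk : 0 < k) : (Polynomial.X : Polynomial ℤ) ^ k ≠ 1 := by
    intro h
    simpa [hk.ne'] using congrArg Polynomial.natDegree h
  have h := congrArg (Polynomial.aeval q) (det_pow_permInv_of_isDomain hX n)
  rw [AlgHom.map_det] at h
  simpa [AlgHom.mapMatrix_apply, Matrix.map, map_prod] using h
end
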